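/- arXiv:1303.1657 — 3 statements merged into one kernel-verified Lean document; each statement's English description precedes it below -/
import Mathlib

section
/- For bond percolation on Z^d (d ≥ 2) and any p ∈ [0,1], the set X of vertices lying in no infinite open cluster has, almost surely, either no infinite connected component or exactly one infinite connected component. -/
open Set Relation Filter

/-- Vertices of the lattice `ℤ^d`. -/
abbrev V (d : ℕ) := Fin d → ℤ

/-- Nearest-neighbour adjacency in `ℤ^d`: `x` and `y` differ by `1` in exactly
one coordinate. -/
def latAdj {d : ℕ} (x y : V d) : Prop :=
  ∃ i, (x i - y i).natAbs = 1 ∧ ∀ j, j ≠ i → x j = y j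

/-- Connectivity in the complement of `S` (paths avoiding `S`). -/
def connAvoid {d : ℕ} (S : Set (V d)) (a b : V d) : Prop :=
  ReflTransGen (fun u v => latAdj u v ∧ u ∉ S ∧ v ∉ S) a b

/-- The connected component of `w` in the complement of `S`. -/
def compOff {d : ℕ} (S : Set (V d)) (w : V d) : Set (V d) :=
  {z | connAvoid S w z}

/-- `y` lies outside `S` and is joined to infinity off `S` (its component in
the complement of `S` is infinite). -/
def toInfOff {d : ℕ} (S : Set (V d)) (y : V d) : Prop :=
  y ∉ S ∧ (compOff S y).Infinite

/-- `S ⊆ ℤ^d` is connected (as an induced subgraph of the lattice). -/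
def IsLatConnected {d : ℕ} (S : Set (V d)) : Prop :=
  ∀ a ∈ S, ∀ b ∈ S, ReflTransGen (fun u v => latAdj u v ∧ u ∈ S ∧ v ∈ S) a b

/-- `S` together with all its holes (the finite components of its complement). -/
def fillHoles {d : ℕ} (S : Set (V d)) : Set (V d) :=
  S ∪ {w | w ∉ S ∧ (compOff S w).Finite}

/-- We identify a plaquette with its dual edge, realized as an unordered pair of
adjacent lattice points.  `PiS S` is the set of plaquettes dual to edges
`⟨x,y⟩` with `x ∈ S` and `y ∉ S` joined to infinity off `S`. -/
def PiS {d : ℕ} (S : Set (V d)) : Set (Sym2 (V d)) :=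
  {e | ∃ x y, latAdj x y ∧ x ∈ S ∧ toInfOff S y ∧ e = s(x, y)}

/-- The `i`-th unit coordinate vector. -/
def uv {d : ℕ} (i : Fin d) : V d := fun k => if k = i then 1 else 0

/-- A unit square (2-facet) of `ℤ^d`; its dual is a `(d-2)`-facet of the dual
lattice `ℤ^d + (1/2,…,1/2)`. -/
structure Square (d : ℕ) where
  corner : V d
  i : Fin d
  j : Fin d
  hij : i ≠ j

/-- The four edges of a unit square.  A plaquette (identified with its dual
edge `e`) is incident to the `(d-2)`-facet dual to the square `F` exactly when
`e` is one of the four edges of `F`. -/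
def edgesOf {d : ℕ} (F : Square d) : Set (Sym2 (V d)) :=
  {s(F.corner, F.corner + uv F.i), s(F.corner, F.corner + uv F.j),
   s(F.corner + uv F.i, F.corner + uv F.i + uv F.j),
   s(F.corner + uv F.j, F.corner + uv F.i + uv F.j)}

/-- A set of plaquettes has empty boundary if every `(d-2)`-facet of the dual
lattice is incident to an even number of its members. -/
def NoBoundary {d : ℕ} (P : Set (Sym2 (V d))) : Prop :=
  ∀ F : Square d, Even (edgesOf F ∩ P).ncard

/-- Two plaquettes are adjacent if their intersection is a `(d-2)`-facet,
equivalently their dual edges are distinct edges of a common unit square. -/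
def plaqAdj {d : ℕ} (e₁ e₂ : Sym2 (V d)) : Prop :=
  e₁ ≠ e₂ ∧ ∃ F : Square d, e₁ ∈ edgesOf F ∧ e₂ ∈ edgesOf F

/-- A set of plaquettes is connected for the adjacency relation `plaqAdj`. -/
def PlaqConnected {d : ℕ} (P : Set (Sym2 (V d))) : Prop :=
  ∀ a ∈ P, ∀ b ∈ P, ReflTransGen (fun u v => plaqAdj u v ∧ u ∈ P ∧ v ∈ P) a b

open MeasureTheory

/-- A bond percolation configuration on `ℤ^d`: a state in `{0,1}` for each
unordered pair of vertices (only the values on edges are relevant). -/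
abbrev Config (d : ℕ) := Sym2 (V d) → Bool

/-- `e` is an edge of the lattice `ℤ^d`. -/
def IsEdge {d : ℕ} (e : Sym2 (V d)) : Prop :=
  ∃ x y, latAdj x y ∧ e = s(x, y)

/-- `x` and `y` are joined by an open path in the configuration `ω`. -/
def openConn {d : ℕ} (ω : Config d) (x y : V d) : Prop :=
  ReflTransGen (fun a b => latAdj a b ∧ ω s(a, b) = true) x y

/-- The open cluster of `x`. -/
def cluster {d : ℕ} (ω : Config d) (x : V d) : Set (V d) :=
  {y | openConn ω x y}

/-- `x` lies in an infinite open cluster (equivalently, `x ↔ ∞`). -/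
def inInfCluster {d : ℕ} (ω : Config d) (x : V d) : Prop :=
  (cluster ω x).Infinite

/-- The set `X` of vertices lying in no infinite open cluster. -/
def Xset {d : ℕ} (ω : Config d) : Set (V d) := {x | ¬ inInfCluster ω x}

/-- The connected component of `x` in the graph induced on `X` by the lattice. -/
def XComp {d : ℕ} (ω : Config d) (x : V d) : Set (V d) :=
  {y | ReflTransGen (fun a b => latAdj a b ∧ a ∈ Xset ω ∧ b ∈ Xset ω) x y}

/-- The event that `X` has an infinite connected component. -/
def XhasInf {d : ℕ} (ω : Config d) : Prop :=
  ∃ x ∈ Xset ω, (XComp ω x).Infinite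

/-- `P` is the law of i.i.d. Bernoulli(`p`) bond percolation: cylinder events
determined by finitely many edges have the product probability. -/
def IsBernoulli {d : ℕ} (P : Measure (Config d)) (p : ℝ) : Prop :=
  ∀ s : Finset (Sym2 (V d)), (∀ e ∈ s, IsEdge e) → ∀ f : Sym2 (V d) → Bool,
    P {ω | ∀ e ∈ s, ω e = f e} =
      ∏ e ∈ s, ENNReal.ofReal (if f e then p else 1 - p)

/-- The critical probability `p_c` of bond percolation on `ℤ^d`:
the supremum of the parameters for which there is a.s. no infinite cluster. -/
noncomputable def pc (d : ℕ) : ℝ :=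
  sSup {p | p ∈ Set.Icc (0 : ℝ) 1 ∧ ∀ P : Measure (Config d),
    IsBernoulli P p → IsProbabilityMeasure P →
      P {ω | ∃ x, inInfCluster ω x} = 0}

/-- The critical value `p_fin`: the supremum of the parameters for which `X`,
the union of the finite open clusters, has an infinite component with positive
probability. -/
noncomputable def pfin (d : ℕ) : ℝ :=
  sSup {p | p ∈ Set.Icc (0 : ℝ) 1 ∧ ∀ P : Measure (Config d),
    IsBernoulli P p → IsProbabilityMeasure P →
      P {ω | XhasInf ω} ≠ 0}

/-- Connectivity inside `S`: there is a lattice path from `a` to `b` all of whose steps stay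
in `S`. -/
def connIn {d : ℕ} (S : Set (V d)) (a b : V d) : Prop :=
  ReflTransGen (fun u v => latAdj u v ∧ u ∈ S ∧ v ∈ S) a b

section Connectivity

variable {d : ℕ} {S T : Set (V d)} {a b c : V d}

theorem latAdj.symm {x y : V d} (h : latAdj x y) : latAdj y x := by
  obtain ⟨i, h1, h2⟩ := h
  exact ⟨i, by omega, fun j hj => (h2 j hj).symm⟩

theorem latAdj_add_right {x y : V d} (v : V d) : latAdj (x + v) (y + v) ↔ latAdj x y := by
  simp [latAdj]

theorem latAdj.mem_Icc {x y : V d} (h : latAdj x y) : y ∈ Set.Icc (x - 1) (x + 1) := by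
  obtain ⟨i, h1, h2⟩ := h
  have key : ∀ k, x k - 1 ≤ y k ∧ y k ≤ x k + 1 := fun k => by
    by_cases hk : k = i
    · subst hk; omega
    · have := h2 k hk; omega
  exact ⟨fun k => (key k).1, fun k => (key k).2⟩

theorem connIn.refl (a : V d) : connIn S a a := ReflTransGen.refl

theorem connIn.trans (h : connIn S a b) (h' : connIn S b c) : connIn S a c :=
  ReflTransGen.trans h h'

theorem connIn.symm (h : connIn S a b) : connIn S b a := by
  have : Std.Symm (fun u v : V d => latAdj u v ∧ u ∈ S ∧ v ∈ S) :=
    ⟨fun _ _ h => ⟨h.1.symm, h.2.2, h.2.1⟩⟩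
  exact Std.Symm.symm (r := ReflTransGen _) _ _ h

theorem connIn.of_adj (h : latAdj a b) (ha : a ∈ S) (hb : b ∈ S) : connIn S a b :=
  ReflTransGen.single ⟨h, ha, hb⟩

theorem connIn.mono (hST : S ⊆ T) (h : connIn S a b) : connIn T a b :=
  ReflTransGen.mono (fun _ _ h => ⟨h.1, hST h.2.1, hST h.2.2⟩) _ _ h

theorem connIn.mem (h : connIn S a b) (ha : a ∈ S) : b ∈ S := by
  induction h with
  | refl => exact ha
  | tail _ h _ => exact h.2.2

/-- A path in `S` is a path in `T` as soon as the component of its origin lies in `T`. -/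
theorem connIn.of_component_subset (h : connIn S a b)
    (hT : ∀ z ∈ S, connIn S a z → z ∈ T) : connIn T a b := by
  induction h with
  | refl => exact .refl _
  | tail h h' ih =>
    exact ih.tail ⟨h'.1, hT _ h'.2.1 h, hT _ h'.2.2 (h.tail h')⟩

theorem connIn_add_right (v : V d) :
    connIn S (a + v) (b + v) ↔ connIn {x | x + v ∈ S} a b := by
  constructor
  · intro h
    have := ReflTransGen.lift (p := fun u w => latAdj u w ∧ u ∈ {x | x + v ∈ S} ∧
      w ∈ {x | x + v ∈ S}) (fun x : V d => x - v) (fun x y hxy => ?_) _ _ h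
    · simpa [connIn, Function.onFun] using this
    · refine ⟨?_, by simpa using hxy.2.1, by simpa using hxy.2.2⟩
      rw [← latAdj_add_right v]; simpa using hxy.1
  · exact ReflTransGen.lift (fun x : V d => x + v)
      (fun x y hxy => ⟨(latAdj_add_right v).2 hxy.1, hxy.2.1, hxy.2.2⟩) _ _

theorem connIn_univ (a b : V d) : connIn univ a b := by
  have step : ∀ (x : V d) (i : Fin d) (n : ℕ),
      connIn univ x (x + n • (Pi.single i 1 : V d)) := by
    intro x i n
    induction n with
    | zero => simpa using connIn.refl x
    | succ n ih =>
      refine ih.tail ⟨⟨i, ?_, fun j hj => ?_⟩, trivial, trivial⟩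
      · simp
      · simp [Pi.single_eq_of_ne hj]
  have step' : ∀ (x : V d) (i : Fin d) (n : ℤ),
      connIn univ x (x + n • (Pi.single i 1 : V d)) := by
    intro x i n
    obtain ⟨m, rfl | rfl⟩ := n.eq_nat_or_neg
    · simpa using step x i m
    · simpa using (step (x + (-(m : ℤ)) • (Pi.single i 1 : V d)) i m).symm
  have sum : ∀ s : Finset (Fin d),
      connIn univ a (a + ∑ i ∈ s, (b i - a i) • (Pi.single i 1 : V d)) := by
    intro s
    induction s using Finset.induction_on with
    | empty => simpa using connIn.refl a
    | insert i s hi ih =>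
      rw [Finset.sum_insert hi, add_comm (_ • _), ← add_assoc]
      exact ih.trans (step' _ i _)
  have h := sum Finset.univ
  have hb : a + ∑ i, (b i - a i) • (Pi.single i 1 : V d) = b := by
    ext k
    simp [Finset.sum_apply, Pi.single_apply]
  rwa [hb] at h

/-- Finitely many points of a component lie in a finite connected subset of it. -/
theorem exists_finset_connIn (ha : a ∈ S) (F : Finset (V d)) (hF : ∀ x ∈ F, connIn S a x) :
    ∃ D : Finset (V d), F ⊆ D ∧ a ∈ D ∧ (D : Set (V d)) ⊆ S ∧ ∀ x ∈ D, connIn (D : Set (V d)) a x := by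
  classical
  have extend : ∀ x, connIn S a x → ∀ D : Finset (V d), a ∈ D → (D : Set (V d)) ⊆ S →
      (∀ x ∈ D, connIn (D : Set (V d)) a x) → ∃ D' : Finset (V d), D ⊆ D' ∧ x ∈ D' ∧
        (D' : Set (V d)) ⊆ S ∧ ∀ x ∈ D', connIn (D' : Set (V d)) a x := by
    intro x hx
    induction hx with
    | refl => exact fun D h1 h2 h3 => ⟨D, subset_rfl, h1, h2, h3⟩
    | @tail y z _ hyz ih =>
      intro D h1 h2 h3
      obtain ⟨D', h4, h5, h6, h7⟩ := ih D h1 h2 h3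
      have hsub : (D' : Set (V d)) ⊆ (insert z D' : Finset (V d)) := by simp
      refine ⟨insert z D', h4.trans (Finset.subset_insert _ _), by simp, ?_, ?_⟩
      · intro w hw
        rcases Finset.mem_insert.1 hw with rfl | hw
        · exact hyz.2.2
        · exact h6 hw
      · intro w hw
        rcases Finset.mem_insert.1 hw with rfl | hw
        · exact ((h7 y h5).mono hsub).trans (.of_adj hyz.1 (by simp [h5]) (by simp))
        · exact (h7 w hw).mono hsub
  induction F using Finset.induction_on with
  | empty =>
    exact ⟨{a}, by simp, by simp, by simpa using ha, by simpa using connIn.refl a⟩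
  | insert x F _ ih =>
    obtain ⟨D, h1, h2, h3, h4⟩ := ih fun y hy => hF y (Finset.mem_insert_of_mem hy)
    obtain ⟨D', h5, h6, h7, h8⟩ := extend x (hF x (Finset.mem_insert_self _ _)) D h2 h3 h4
    exact ⟨D', Finset.insert_subset h6 (h1.trans h5), h5 h2, h7, h8⟩

/-- Removing a finite set from an infinite component leaves an infinite component, adjacent to
the removed set if that set meets the component. -/
theorem exists_infinite_component_diff (D : Finset (V d))
    (hinf : {y | connIn S a y}.Infinite) :
    ∃ z, connIn S a z ∧ z ∉ D ∧ {y | connIn (S \ D) z y}.Infinite ∧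
      ((∃ x ∈ D, connIn S a x) → ∃ x ∈ D, latAdj x z) := by
  classical
  by_cases hD : ∃ x ∈ D, connIn S a x
  swap
  · push Not at hD
    refine ⟨a, .refl _, fun h => hD a h (.refl _), hinf.mono fun y hy => ?_, fun h => ?_⟩
    · exact hy.of_component_subset fun z hz haz => ⟨hz, fun h => hD z h haz⟩
    · obtain ⟨x, hx, h⟩ := h
      exact (hD x hx h).elim
  obtain ⟨x, hxD, hx⟩ := hD
  have exit : ∀ z, connIn S z x → z ∉ D →
      ∃ w, w ∉ D ∧ (∃ u ∈ D, latAdj u w) ∧ connIn (S \ D) z w := by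
    intro z hz
    induction hz using ReflTransGen.head_induction_on with
    | refl => exact fun h => (h hxD).elim
    | @head z z' h _ ih =>
      intro hzD
      by_cases hz' : z' ∈ D
      · exact ⟨z, hzD, ⟨z', hz', h.1.symm⟩, .refl _⟩
      · obtain ⟨w, h1, h2, h3⟩ := ih hz'
        exact ⟨w, h1, h2, h3.head ⟨h.1, ⟨h.2.1, hzD⟩, ⟨h.2.2, hz'⟩⟩⟩
  by_contra! hcon
  set N : Finset (V d) := D.biUnion fun u => Finset.Icc (u - 1) (u + 1)
  have hfin : ((D : Set (V d)) ∪ ⋃ w ∈ {w | w ∈ N ∧ connIn S a w ∧ w ∉ D ∧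
      ∃ u ∈ D, latAdj u w}, {y | connIn (S \ D) w y}).Finite := by
    refine D.finite_toSet.union (Set.Finite.biUnion (N.finite_toSet.subset fun w hw => hw.1) ?_)
    rintro w ⟨-, h2, h3, u, hu, huw⟩
    by_contra h
    exact (hcon w h2 h3 h).2 u hu huw
  refine hinf (hfin.subset fun z hz => ?_)
  by_cases hzD : z ∈ D
  · exact Or.inl hzD
  obtain ⟨w, h1, ⟨u, hu, huw⟩, h3⟩ := exit z (connIn.symm (hz : connIn S a z) |>.trans hx) hzD
  refine Or.inr (mem_biUnion (x := w) ⟨?_, ?_, h1, u, hu, huw⟩ h3.symm)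
  · exact Finset.mem_biUnion.2 ⟨u, hu, Finset.mem_Icc.2 huw.mem_Icc⟩
  · exact connIn.trans hz (h3.mono sdiff_subset)

end Connectivity

section Trifurcation

variable {d : ℕ} {X : Set (V d)} {D : Finset (V d)} {a : Fin 3 → V d}

/-- `D` is a finite connected subset of `X` whose removal creates the three distinct adjacent
components of `a 0`, `a 1`, `a 2`. -/
structure IsTrifurcation (X : Set (V d)) (D : Finset (V d)) (a : Fin 3 → V d) : Prop where
  subset : (D : Set (V d)) ⊆ X
  conn : ∀ x ∈ D, ∀ y ∈ D, connIn (D : Set (V d)) x y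
  adj : ∀ j, ∃ x ∈ D, latAdj x (a j)
  mem : ∀ j, a j ∈ X \ D
  sep : ∀ j k, connIn (X \ D) (a j) (a k) → j = k

theorem IsTrifurcation.connIn_diff (h : IsTrifurcation X D a) {D' : Finset (V d)}
    (hD : Disjoint D D') (j : Fin 3) (hj : ∀ z ∈ D', ¬ connIn (X \ D) (a j) z) {x y : V d}
    (hy : connIn (X \ D) (a j) y) (hx : x ∈ D) : connIn (X \ D') y x := by
  obtain ⟨x₀, hx₀, hadj⟩ := h.adj j
  have hsub : (D : Set (V d)) ⊆ X \ D' := fun z hz =>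
    ⟨h.subset hz, Finset.disjoint_left.1 hD hz⟩
  have h1 : connIn (X \ D') (a j) y :=
    hy.of_component_subset fun z hz haz => ⟨hz.1, fun hzD' => hj z hzD' haz⟩
  have h2 : connIn (X \ D') (a j) x₀ :=
    .of_adj hadj.symm ⟨(h.mem j).1, fun h' => hj _ h' (.refl _)⟩ (hsub hx₀)
  exact h1.symm.trans (h2.trans ((h.conn _ hx₀ _ hx).mono hsub))

/-- Disjoint trifurcations all of whose branches meet `Y` are at most as many as the points
of `Y`. -/
theorem card_trifurcation_le {ι : Type*} (I : Finset ι) (D : ι → Finset (V d))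
    (a : ι → Fin 3 → V d) (Y : Finset (V d)) (h : ∀ i ∈ I, IsTrifurcation X (D i) (a i))
    (hdisj : ∀ i ∈ I, ∀ j ∈ I, i ≠ j → Disjoint (D i) (D j))
    (hY : ∀ i ∈ I, ∀ j, ∃ y ∈ Y, connIn (X \ D i) (a i j) y) : I.card ≤ Y.card := by
  classical
  obtain ⟨g, hg⟩ := exists_injective_nat (V d)
  have hmin : ∀ i ∈ I, ∀ j, ∃ y ∈ Y, connIn (X \ D i) (a i j) y ∧
      ∀ y' ∈ Y, connIn (X \ D i) (a i j) y' → g y ≤ g y' := by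
    intro i hi j
    obtain ⟨y₀, hy₀, hc⟩ := hY i hi j
    obtain ⟨y, hy, hle⟩ := Finset.exists_min_image
      (Y.filter fun y => connIn (X \ D i) (a i j) y) g ⟨y₀, by simp [hy₀, hc]⟩
    simp only [Finset.mem_filter] at hy hle
    exact ⟨y, hy.1, hy.2, fun y' h1 h2 => hle y' ⟨h1, h2⟩⟩
  choose! m hmY hmc hmle using hmin
  choose J hJ using fun i => Finite.exists_max fun j => g (m i j)
  have key : ∀ i ∈ I, ∀ i' ∈ I, i ≠ i' → m i (J i) = m i' (J i') →
      ∀ x ∈ D i, ¬ connIn (X \ D i') (a i' (J i')) x := by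
    intro i hi i' hi' hne heq x hx hcx
    have hsub : (D i' : Set (V d)) ⊆ X \ D i := fun z hz =>
      ⟨(h i' hi').subset hz, Finset.disjoint_right.1 (hdisj i hi i' hi' hne) hz⟩
    obtain ⟨j, hjJ, hj⟩ : ∃ j, j ≠ J i ∧ ∀ z ∈ D i', ¬ connIn (X \ D i) (a i j) z := by
      have hJ12 : ∀ J : Fin 3, ∃ j k : Fin 3, j ≠ J ∧ k ≠ J ∧ j ≠ k := by decide
      obtain ⟨j, k, hjJ, hkJ, hjk⟩ := hJ12 (J i)
      by_contra! hcon
      obtain ⟨z, hz, hzc⟩ := hcon j hjJ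
      obtain ⟨w, hw, hwc⟩ := hcon k hkJ
      exact hjk ((h i hi).sep j k
        (hzc.trans ((((h i' hi').conn z hz w hw).mono hsub).trans hwc.symm)))
    have h1 := (h i hi).connIn_diff (hdisj i hi i' hi' hne) j hj (hmc i hi j) hx
    have h2 := hmle i' hi' (J i') _ (hmY i hi j) (hcx.trans h1.symm)
    have h3 : m i j = m i (J i) := hg (le_antisymm (hJ i j) (heq ▸ h2))
    exact hjJ ((h i hi).sep _ _ ((hmc i hi j).trans (h3 ▸ (hmc i hi (J i)).symm)))
  refine Finset.card_le_card_of_injOn (fun i => m i (J i)) (fun i hi => hmY i hi _) ?_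
  intro i hi i' hi' heq
  by_contra hne
  obtain ⟨x, hx, -⟩ := (h i hi).adj 0
  by_cases hz : ∃ z ∈ D i', connIn (X \ D i) (a i (J i)) z
  · obtain ⟨z, hz, hc⟩ := hz
    exact key i' hi' i hi (Ne.symm hne) heq.symm z hz hc
  · push Not at hz
    refine key i hi i' hi' hne heq x hx ?_
    have h1 := (h i hi).connIn_diff (hdisj i hi i' hi' hne) _ hz (hmc i hi _) hx
    have heq' : m i (J i) = m i' (J i') := heq
    exact (hmc i' hi' (J i')).trans (heq' ▸ h1)

end Trifurcation

section InfiniteComponents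

variable {d : ℕ} {X X' : Set (V d)}

/-- `x` lies in an infinite connected component of `X`. -/
def InfComp (X : Set (V d)) (x : V d) : Prop :=
  {y | connIn X x y}.Infinite

/-- `X` has exactly one infinite connected component. -/
def UniqueInfComp (X : Set (V d)) : Prop :=
  (∃ x, InfComp X x) ∧ ∀ x y, InfComp X x → InfComp X y → connIn X x y

theorem InfComp.mem {x : V d} (h : InfComp X x) : x ∈ X := by
  obtain ⟨y, hy, hne⟩ := Set.Infinite.exists_notMem_finset h {x}
  rcases ReflTransGen.cases_head hy with h' | ⟨z, hz, -⟩
  · simp [h'] at hne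
  · exact hz.2.1

theorem InfComp.mono (hX : X ⊆ X') {x : V d} (h : InfComp X x) : InfComp X' x :=
  Set.Infinite.mono (fun _ hy => connIn.mono hX hy) h

/-- Joining three infinite components by adding finitely many points creates a trifurcation. -/
theorem exists_trifurcation (hX : X ⊆ X') (hfin : (X' \ X).Finite) (x : Fin 3 → V d)
    (hinf : ∀ j, InfComp X (x j)) (hsep : ∀ j k, connIn X (x j) (x k) → j = k)
    (hconn : ∀ j, connIn X' (x 0) (x j)) :
    ∃ D a, IsTrifurcation X' D a ∧ ∀ j, InfComp (X' \ D) (a j) := by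
  classical
  obtain ⟨D, hFD, h0D, hDX, hD⟩ := exists_finset_connIn (hX (hinf 0).mem)
    ((hfin.toFinset.filter fun z => connIn X' (x 0) z) ∪ Finset.univ.image x) (by
      intro z hz
      simp only [Finset.mem_union, Finset.mem_filter, Finset.mem_image, Finset.mem_univ,
        true_and] at hz
      rcases hz with hz | ⟨j, rfl⟩
      · exact hz.2
      · exact hconn j)
  have hxD : ∀ j, x j ∈ D := fun j => hFD (by simp)
  choose a ha haD hainf hadj using fun j => exists_infinite_component_diff D (hinf j)
  refine ⟨D, a, ⟨hDX, fun y hy z hz => (hD y hy).symm.trans (hD z hz),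
    fun j => hadj j ⟨x j, hxD j, .refl _⟩, fun j => ⟨hX ((ha j).mem (hinf j).mem), haD j⟩, ?_⟩,
    fun j => InfComp.mono (sdiff_subset_sdiff_left hX) (hainf j)⟩
  intro j k h
  refine hsep j k ((ha j).trans (connIn.trans ?_ (ha k).symm))
  refine h.of_component_subset fun z hz hjz => ?_
  by_contra hzX
  refine hz.2 (hFD (Finset.mem_union_left _ (Finset.mem_filter.2 ⟨?_, ?_⟩)))
  · exact hfin.mem_toFinset.2 ⟨hz.1, hzX⟩
  · exact (hconn j).trans (((ha j).mono hX).trans (hjz.mono sdiff_subset))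

/-- Joining the only two infinite components by adding finitely many points leaves a unique
infinite component. -/
theorem uniqueInfComp_of_join (hX : X ⊆ X') (hfin : (X' \ X).Finite) {x y : V d}
    (hinf : InfComp X x) (hall : ∀ z, InfComp X z → connIn X x z ∨ connIn X y z)
    (hconn : connIn X' x y) : UniqueInfComp X' := by
  have key : ∀ z, InfComp X' z → connIn X' x z := by
    intro z hz
    obtain ⟨w, hzw, -, hw, -⟩ := exists_infinite_component_diff hfin.toFinset hz
    have hwX : InfComp X w := InfComp.mono (by simp) hw
    rcases hall w hwX with h | h
    · exact (h.mono hX).trans hzw.symm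
    · exact hconn.trans ((h.mono hX).trans hzw.symm)
  exact ⟨⟨x, hinf.mono hX⟩, fun u v hu hv => (key u hu).symm.trans (key v hv)⟩

theorem infComp_add_right (v x : V d) : InfComp X (x + v) ↔ InfComp {y | y + v ∈ X} x := by
  unfold InfComp
  have h : {y | connIn {y | y + v ∈ X} x y} = (· + v) ⁻¹' {y | connIn X (x + v) y} := by
    ext y
    exact (connIn_add_right v).symm
  rw [h]
  rw [← Set.infinite_image_iff (f := (· + v)) (s := (· + v) ⁻¹' _) (add_left_injective v).injOn,
    Set.image_preimage_eq _ (add_right_surjective v)]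

theorem uniqueInfComp_add_right (v : V d) :
    UniqueInfComp {y | y + v ∈ X} ↔ UniqueInfComp X := by
  simp only [UniqueInfComp, ← infComp_add_right, ← connIn_add_right]
  have hs := add_right_surjective v
  rw [← hs.exists (p := fun x => InfComp X x)]
  refine and_congr_right fun _ => ⟨fun h x y => ?_, fun h x y => h _ _⟩
  simpa using h (x - v) (y - v)

end InfiniteComponents

section Closing

variable {d : ℕ}

open Classical in
/-- The configuration obtained from `ω` by closing all edges between points of `U`. -/
noncomputable def closeOn (U : Finset (V d)) (ω : Config d) : Config d :=
  fun e => if e ∈ U.sym2 then false else ω e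

theorem openConn.symm {ω : Config d} {x y : V d} (h : openConn ω x y) : openConn ω y x := by
  have : Std.Symm (fun a b : V d => latAdj a b ∧ ω s(a, b) = true) :=
    ⟨fun _ _ h => ⟨h.1.symm, Sym2.eq_swap ▸ h.2⟩⟩
  exact Std.Symm.symm (r := ReflTransGen _) _ _ h

theorem openConn_of_closeOn {U : Finset (V d)} {ω : Config d} {x y : V d}
    (h : openConn (closeOn U ω) x y) : openConn ω x y := by
  refine ReflTransGen.mono (fun a b hab => ⟨hab.1, ?_⟩) _ _ h
  have := hab.2
  unfold closeOn at this
  split_ifs at this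
  exact this

theorem Xset_subset_closeOn (U : Finset (V d)) (ω : Config d) :
    Xset ω ⊆ Xset (closeOn U ω) := fun _ hx h =>
  hx (Set.Infinite.mono (fun _ hy => openConn_of_closeOn hy) h)

/-- Closing finitely many edges adds finitely many points to `X`. -/
theorem finite_Xset_closeOn_diff (U : Finset (V d)) (ω : Config d) :
    (Xset (closeOn U ω) \ Xset ω).Finite := by
  refine Set.Finite.subset (s := ⋃ u ∈ {u | u ∈ U ∧ (cluster (closeOn U ω) u).Finite},
    cluster (closeOn U ω) u)
    (Set.Finite.biUnion (U.finite_toSet.subset fun u hu => hu.1) fun u hu => hu.2) ?_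
  rintro x ⟨hx', hx⟩
  have hx' : (cluster (closeOn U ω) x).Finite := by simpa [Xset, inInfCluster] using hx'
  have hx : (cluster ω x).Infinite := by simpa [Xset, inInfCluster] using hx
  obtain ⟨u, hu, hxu⟩ : ∃ u ∈ U, openConn (closeOn U ω) x u := by
    by_contra! hcon
    refine hx (hx'.subset fun y hy => ?_)
    change openConn (closeOn U ω) x y
    replace hy : openConn ω x y := hy
    induction hy with
    | refl => exact .refl
    | @tail b c _ hbc ih =>
      refine ih.tail ⟨hbc.1, ?_⟩
      rw [closeOn, if_neg, hbc.2]
      exact fun h => hcon b (Finset.mk_mem_sym2_iff.1 h).1 ih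
  exact mem_biUnion (x := u) ⟨hu, hx'.subset fun y hy => hxu.trans hy⟩ hxu.symm

/-- Isolating the points of a finite set puts them into `X`. -/
theorem exists_subset_Xset_closeOn (B : Finset (V d)) :
    ∃ U : Finset (V d), ∀ ω : Config d, (B : Set (V d)) ⊆ Xset (closeOn U ω) := by
  classical
  refine ⟨B.biUnion fun u => Finset.Icc (u - 1) (u + 1), fun ω b hb h => h ?_⟩
  refine (Set.finite_singleton b).subset fun y hy => ?_
  rcases ReflTransGen.cases_head hy with h' | ⟨z, hz, -⟩
  · exact h'.symm
  · have hopen := hz.2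
    rw [closeOn, if_pos] at hopen
    · simp at hopen
    · refine Finset.mk_mem_sym2_iff.2 ⟨?_, ?_⟩ <;> refine Finset.mem_biUnion.2 ⟨b, hb, ?_⟩
      · have h01 : (0 : V d) ≤ 1 := zero_le_one
        simp [h01]
      · exact Finset.mem_Icc.2 hz.1.mem_Icc

end Closing

section TrifurcationBound

variable {d : ℕ} {X : Set (V d)}

/-- `D` is a trifurcation of `X` with infinite branches. -/
def InfTrifurcation (X : Set (V d)) (D : Finset (V d)) (a : Fin 3 → V d) : Prop :=
  IsTrifurcation X D a ∧ ∀ j, InfComp (X \ D) (a j)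

theorem InfTrifurcation.translate {D : Finset (V d)} {a : Fin 3 → V d} {v : V d}
    (h : InfTrifurcation {y | y + v ∈ X} D a) :
    InfTrifurcation X (D.map (addRightEmbedding v)) (fun j => a j + v) := by
  have hmem : ∀ y, y + v ∈ D.map (addRightEmbedding v) ↔ y ∈ D := fun y => by simp
  have hdiff : {y | y + v ∈ X \ (D.map (addRightEmbedding v) : Finset (V d))} =
      {y | y + v ∈ X} \ D := by
    ext y
    simp [-Finset.coe_map, hmem]
  have hD : {y | y + v ∈ ((D.map (addRightEmbedding v) : Finset (V d)) : Set (V d))} = D := by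
    ext y
    simp [-Finset.coe_map, hmem]
  obtain ⟨⟨h1, h2, h3, h4, h5⟩, h6⟩ := h
  refine ⟨⟨?_, ?_, fun j => ?_, fun j => ?_, fun j k => ?_⟩, fun j => ?_⟩
  · intro y hy
    obtain ⟨x, hx, rfl⟩ := Finset.mem_map.1 hy
    exact h1 hx
  · intro y hy z hz
    obtain ⟨y, hy', rfl⟩ := Finset.mem_map.1 hy
    obtain ⟨z, hz', rfl⟩ := Finset.mem_map.1 hz
    have := h2 y hy' z hz'
    rw [← hD] at this
    exact (connIn_add_right v).2 this
  · obtain ⟨x, hx, hadj⟩ := h3 j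
    exact ⟨x + v, (hmem x).2 hx, (latAdj_add_right v).2 hadj⟩
  · have := h4 j
    rwa [← hdiff] at this
  · rw [connIn_add_right, hdiff]
    exact h5 j k
  · rw [infComp_add_right, hdiff]
    exact h6 j

theorem exists_exit {S : Set (V d)} {B : Finset (V d)} {a z : V d} (h : connIn S a z)
    (ha : a ∈ B) (hz : z ∉ B) : ∃ y, connIn S a y ∧ y ∉ B ∧ ∃ u ∈ B, latAdj u y := by
  induction h with
  | refl => exact (hz ha).elim
  | @tail b c hb hbc ih =>
    by_cases hbB : b ∈ B
    · exact ⟨c, hb.tail hbc, hz, b, hbB, hbc.1⟩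
    · exact ih hbB

open Classical in
/-- The number of translates of a trifurcation inside a box is at most the size of the boundary
of the box. -/
theorem card_infTrifurcation_le (D : Finset (V d)) (a : Fin 3 → V d) (m n : ℕ)
    (hD : ∀ x ∈ D, ∀ i, -(m : ℤ) ≤ x i ∧ x i ≤ m) (ha : ∀ j i, -(m : ℤ) ≤ a j i ∧ a j i ≤ m) :
    (Finset.univ.filter fun k : Fin d → Fin n =>
      InfTrifurcation {y | y + (fun i => (2 * m + 1 : ℤ) * (k i : ℕ)) ∈ X} D a).card ≤
      ((2 * m + 1) * n + 2) ^ d - ((2 * m + 1) * n) ^ d := by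
  set w : ℤ := 2 * m + 1 with hw
  set v : (Fin d → Fin n) → V d := fun k i => w * (k i : ℕ) with hv
  set B : Finset (V d) := Finset.Icc (fun _ => -(m : ℤ)) (fun _ => w * n - m - 1)
  set B' : Finset (V d) := Finset.Icc (fun _ => -(m : ℤ) - 1) (fun _ => w * n - m)
  have hBB' : B ⊆ B' := Finset.Icc_subset_Icc (fun _ => by simp) (fun _ => by simp)
  have hcard : (B' \ B).card = ((2 * m + 1) * n + 2) ^ d - ((2 * m + 1) * n) ^ d := by
    have h1 : (w * n - m + 1 - (-(m : ℤ) - 1)).toNat = (2 * m + 1) * n + 2 := by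
      rw [hw]
      have : ((2 * m + 1 : ℤ) * n - m + 1 - (-(m : ℤ) - 1)) =
        (((2 * m + 1) * n + 2 : ℕ) : ℤ) := by push_cast; ring
      rw [this, Int.toNat_natCast]
    have h2 : (w * n - m - 1 + 1 - (-(m : ℤ))).toNat = (2 * m + 1) * n := by
      rw [hw]
      have : ((2 * m + 1 : ℤ) * n - m - 1 + 1 - (-(m : ℤ))) =
        (((2 * m + 1) * n : ℕ) : ℤ) := by push_cast; ring
      rw [this, Int.toNat_natCast]
    rw [Finset.card_sdiff_of_subset hBB', Pi.card_Icc, Pi.card_Icc]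
    simp only [Int.card_Icc, h1, h2, Finset.prod_const, Finset.card_univ, Fintype.card_fin]
  have hin : ∀ k : Fin d → Fin n, ∀ x : V d, (∀ i, -(m : ℤ) ≤ x i ∧ x i ≤ m) → x + v k ∈ B := by
    intro k x hx
    refine Finset.mem_Icc.2 ⟨fun i => ?_, fun i => ?_⟩
    · have h1 := (hx i).1
      have h2 : 0 ≤ w * ((k i : ℕ) : ℤ) := by positivity
      simp only [hv, Pi.add_apply]
      linarith
    · have h1 := (hx i).2
      have h3 : ((k i : ℕ) : ℤ) + 1 ≤ n := by exact_mod_cast (k i).2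
      have h2 : w * (((k i : ℕ) : ℤ) + 1) ≤ w * n := mul_le_mul_of_nonneg_left h3 (by positivity)
      simp only [hv, Pi.add_apply]
      linarith
  rw [← hcard]
  refine card_trifurcation_le (X := X) _ (fun k => D.map (addRightEmbedding (v k)))
    (fun k j => a j + v k) _ (fun k hk => (Finset.mem_filter.1 hk).2.translate.1) ?_ ?_
  · intro k _ k' _ hne
    rw [Finset.disjoint_left]
    intro z hz hz'
    obtain ⟨x, hx, rfl⟩ := Finset.mem_map.1 hz
    obtain ⟨x', hx', heq⟩ := Finset.mem_map.1 hz'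
    refine hne (funext fun i => Fin.ext ?_)
    have h1 := hD x hx i
    have h2 := hD x' hx' i
    have h3 : x' i + w * (k' i : ℕ) = x i + w * (k i : ℕ) := congrFun heq i
    have h4 : w * (((k i : ℕ) : ℤ) - (k' i : ℕ)) = x' i - x i := by linarith
    have h5 : ((k i : ℕ) : ℤ) - (k' i : ℕ) = 0 := by
      by_contra hne0
      have : w ≤ |w * (((k i : ℕ) : ℤ) - (k' i : ℕ))| := by
        rw [abs_mul, abs_of_pos (by positivity : 0 < w)]
        exact le_mul_of_one_le_right (by positivity) (Int.one_le_abs hne0)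
      rw [h4] at this
      have := abs_le.2 (⟨by linarith, by linarith⟩ : -(2 * m : ℤ) ≤ x' i - x i ∧ _ ≤ (2 * m : ℤ))
      linarith
    exact_mod_cast sub_eq_zero.1 h5
  · intro k hk j
    obtain ⟨z, hz, hzB⟩ :=
      Set.Infinite.exists_notMem_finset ((Finset.mem_filter.1 hk).2.translate.2 j) B
    obtain ⟨y, hy, hyB, u, hu, huy⟩ := exists_exit hz (hin k _ (ha j)) hzB
    refine ⟨y, Finset.mem_sdiff.2 ⟨?_, hyB⟩, hy⟩
    have hy' := huy.mem_Icc
    have hu' := Finset.mem_Icc.1 hu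
    refine Finset.mem_Icc.2 ⟨fun i => ?_, fun i => ?_⟩
    · have h1 := hu'.1 i
      have h2 := hy'.1 i
      simp only [Pi.sub_apply, Pi.one_apply] at h2
      linarith
    · have h1 := hu'.2 i
      have h2 := hy'.2 i
      simp only [Pi.add_apply, Pi.one_apply] at h2
      linarith

end TrifurcationBound

section Measurability

variable {Ω : Type*} [MeasurableSpace Ω] {α : Type*} [Countable α]

theorem measurableSet_reflTransGen {r : Ω → α → α → Prop}
    (hr : ∀ a b, MeasurableSet {ω | r ω a b}) (a b : α) :
    MeasurableSet {ω | ReflTransGen (r ω) a b} := by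
  let reach : ℕ → Ω → α → Prop := fun n ω =>
    Nat.rec (fun x => a = x) (fun _ q x => ∃ c, q c ∧ r ω c x) n
  have hreach : ∀ n x, MeasurableSet {ω | reach n ω x} := by
    intro n
    induction n with
    | zero => exact fun x => .const _
    | succ n ih =>
      exact fun x => measurableSet_setOfPred.2 (Measurable.exists fun c =>
        (measurableSet_setOfPred.1 (ih c)).and (measurableSet_setOfPred.1 (hr c x)))
  have heq : {ω | ReflTransGen (r ω) a b} = ⋃ n, {ω | reach n ω b} := by
    ext ω
    simp only [mem_ofPred_eq, mem_iUnion]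
    constructor
    · intro h
      induction h with
      | refl => exact ⟨0, rfl⟩
      | @tail c x _ hcx ih =>
        obtain ⟨n, hn⟩ := ih
        exact ⟨n + 1, c, hn, hcx⟩
    · rintro ⟨n, hn⟩
      induction n generalizing b with
      | zero => exact (show a = b from hn) ▸ .refl
      | succ n ih =>
        obtain ⟨c, hc, hcb⟩ := hn
        exact (ih c hc).tail hcb
  rw [heq]
  exact .iUnion fun n => hreach n b

theorem measurableSet_infinite {q : Ω → α → Prop} (hq : ∀ y, MeasurableSet {ω | q ω y}) :
    MeasurableSet {ω | {y | q ω y}.Infinite} := by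
  have heq : {ω | {y | q ω y}.Infinite} = ⋂ F : Finset α, ⋃ y ∈ {y | y ∉ F}, {ω | q ω y} := by
    ext ω
    simp only [mem_ofPred_eq, mem_iInter, mem_iUnion, exists_prop]
    refine ⟨fun h F => ?_, fun h hfin => ?_⟩
    · obtain ⟨y, hy, hyF⟩ := h.exists_notMem_finset F
      exact ⟨y, hyF, hy⟩
    · obtain ⟨y, hyF, hy⟩ := h hfin.toFinset
      exact hyF (hfin.mem_toFinset.2 hy)
  rw [heq]
  exact .iInter fun F => .biUnion (Set.to_countable _) fun y _ => hq y

variable {d : ℕ} {X : Ω → Set (V d)}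

theorem measurableSet_connIn (hX : ∀ x, MeasurableSet {ω | x ∈ X ω}) (a b : V d) :
    MeasurableSet {ω | connIn (X ω) a b} :=
  measurableSet_reflTransGen (fun x y => (MeasurableSet.const _).inter
    ((hX x).inter (hX y))) a b

theorem measurableSet_infComp (hX : ∀ x, MeasurableSet {ω | x ∈ X ω}) (a : V d) :
    MeasurableSet {ω | InfComp (X ω) a} :=
  measurableSet_infinite fun y => measurableSet_connIn hX a y

theorem measurableSet_uniqueInfComp (hX : ∀ x, MeasurableSet {ω | x ∈ X ω}) :
    MeasurableSet {ω | UniqueInfComp (X ω)} := by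
  have h1 := fun x => measurableSet_setOfPred.1 (measurableSet_infComp hX x)
  have h2 := fun x y => measurableSet_setOfPred.1 (measurableSet_connIn hX x y)
  exact measurableSet_setOfPred.2 ((Measurable.exists h1).and (Measurable.forall fun x =>
    Measurable.forall fun y => (h1 x).imp ((h1 y).imp (h2 x y))))

theorem measurableSet_infTrifurcation (hX : ∀ x, MeasurableSet {ω | x ∈ X ω})
    (D : Finset (V d)) (a : Fin 3 → V d) :
    MeasurableSet {ω | InfTrifurcation (X ω) D a} := by
  have hXD : ∀ x, MeasurableSet {ω | x ∈ X ω \ D} := fun x => (hX x).inter (.const _)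
  have heq : {ω | InfTrifurcation (X ω) D a} =
      ((⋂ x ∈ D, {ω | x ∈ X ω}) ∩ {_ω | (∀ x ∈ D, ∀ y ∈ D, connIn (D : Set (V d)) x y) ∧
        ∀ j, ∃ x ∈ D, latAdj x (a j)} ∩ (⋂ j, {ω | a j ∈ X ω \ D}) ∩
        (⋂ j, ⋂ k, {ω | connIn (X ω \ D) (a j) (a k) → j = k})) ∩
        ⋂ j, {ω | InfComp (X ω \ D) (a j)} := by
    ext ω
    simp only [mem_inter_iff, mem_iInter, mem_ofPred_eq]
    exact ⟨fun ⟨h, h'⟩ => ⟨⟨⟨⟨fun x hx => h.subset hx, h.conn, h.adj⟩, h.mem⟩, h.sep⟩, h'⟩,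
      fun ⟨⟨⟨⟨h1, h2⟩, h3⟩, h4⟩, h5⟩ => ⟨⟨fun x hx => h1 x hx, h2.1, h2.2, h3, h4⟩, h5⟩⟩
  rw [heq]
  refine ((((Finset.measurableSet_biInter _ fun x _ => hX x).inter (.const _)).inter
    (.iInter fun j => hXD _)).inter (.iInter fun j => .iInter fun k => ?_)).inter
    (.iInter fun j => measurableSet_infComp hXD _)
  exact measurableSet_setOfPred.2
    ((measurableSet_setOfPred.1 (measurableSet_connIn hXD _ _)).imp measurable_const)

theorem measurableSet_mem_Xset (x : V d) : MeasurableSet {ω : Config d | x ∈ Xset ω} := by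
  refine (measurableSet_infinite fun y => ?_).compl
  refine measurableSet_reflTransGen (fun a b => (MeasurableSet.const _).inter ?_) x y
  have h : Measurable fun ω : Config d => ω s(a, b) := measurable_pi_apply _
  exact h (measurableSet_singleton true)

end Measurability

section BondMeasure

open ProbabilityTheory unitInterval

variable {d : ℕ} (p : I)

open Classical in
/-- The parameter of the Bernoulli variable attached to an unordered pair: `p` on edges, `0` on
pairs which are not edges. -/
noncomputable def bondParam (e : Sym2 (V d)) : I := if IsEdge e then p else 0

/-- The law of the state of an unordered pair. -/
noncomputable def bondLaw (e : Sym2 (V d)) : Measure Bool :=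
  ENNReal.ofReal (bondParam p e) • Measure.dirac true +
    ENNReal.ofReal (1 - bondParam p e) • Measure.dirac false

theorem bondLaw_singleton (e : Sym2 (V d)) (b : Bool) :
    bondLaw p e {b} = ENNReal.ofReal (if b then bondParam p e else 1 - bondParam p e) := by
  cases b <;> simp [bondLaw]

instance (e : Sym2 (V d)) : IsProbabilityMeasure (bondLaw p e) where
  measure_univ := by
    have h := (bondParam p e).2
    simp [bondLaw, ← ENNReal.ofReal_add h.1 (sub_nonneg.2 h.2)]

/-- The law of bond percolation, all pairs which are not edges being closed. -/
noncomputable def bondMeasure (d : ℕ) (p : I) : Measure (Config d) :=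
  Measure.infinitePi (bondLaw p)

instance : IsProbabilityMeasure (bondMeasure d p) :=
  inferInstanceAs (IsProbabilityMeasure (Measure.infinitePi _))

open Classical in
/-- Close all pairs which are not edges. -/
noncomputable def edgePart (ω : Config d) : Config d := fun e => if IsEdge e then ω e else false

theorem measurable_edgePart : Measurable (edgePart (d := d)) := by
  refine measurable_pi_iff.2 fun e => ?_
  unfold edgePart
  split_ifs
  · exact measurable_pi_apply e
  · exact measurable_const

theorem Xset_edgePart (ω : Config d) : Xset (edgePart ω) = Xset ω := by
  have h : ∀ a b : V d, (latAdj a b ∧ edgePart ω s(a, b) = true) ↔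
      (latAdj a b ∧ ω s(a, b) = true) := fun a b => and_congr_right fun hab => by
    rw [edgePart, if_pos ⟨a, b, hab, rfl⟩]
  simp only [Xset, inInfCluster, cluster, openConn, h]

variable {p} in
theorem map_edgePart {P : Measure (Config d)} [IsProbabilityMeasure P] (hP : IsBernoulli P p) :
    P.map edgePart = bondMeasure d p := by
  classical
  refine ((Measure.isProjectiveLimit_infinitePi _).unique fun s => ?_).symm
  refine Measure.ext_of_singleton fun g => ?_
  rw [Measure.map_map (by fun_prop) measurable_edgePart, Measure.pi_singleton,
    Measure.map_apply ((by fun_prop : Measurable s.restrict).comp measurable_edgePart)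
      (measurableSet_singleton g)]
  set f : Sym2 (V d) → Bool := fun e => if h : e ∈ s then g ⟨e, h⟩ else false
  have hfg : ∀ e : s, f e = g e := fun e => dif_pos e.2
  have hset : (s.restrict ∘ edgePart) ⁻¹' {g} = {ω | ∀ e ∈ s, edgePart ω e = f e} := by
    ext ω
    simp only [mem_preimage, mem_singleton_iff, mem_ofPred_eq, funext_iff, Function.comp_apply,
      Finset.restrict, ← hfg, Subtype.forall]
  simp only [hset, ← hfg, bondLaw_singleton]
  rw [Finset.prod_coe_sort s fun e =>
    ENNReal.ofReal (if f e then bondParam p e else 1 - bondParam p e)]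
  by_cases hf : ∃ e ∈ s, ¬ IsEdge e ∧ f e = true
  · obtain ⟨e, hes, he, hfe⟩ := hf
    rw [Finset.prod_eq_zero hes (by simp [hfe, bondParam, he])]
    refine measure_mono_null (fun ω hω => ?_) measure_empty
    have := hω e hes
    simp [edgePart, he, hfe] at this
  · push Not at hf
    rw [← Finset.prod_filter_mul_prod_filter_not s IsEdge]
    rw [Finset.prod_congr rfl fun e he => by
      rw [bondParam, if_pos (Finset.mem_filter.1 he).2],
      Finset.prod_eq_one (s := s.filter fun e => ¬ IsEdge e) fun e he => ?_, mul_one,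
      ← hP _ fun e he => (Finset.mem_filter.1 he).2]
    · congr 1
      ext ω
      refine ⟨fun h e he => ?_, fun h e he => ?_⟩
      · rw [← h e (Finset.mem_filter.1 he).1, edgePart, if_pos (Finset.mem_filter.1 he).2]
      · by_cases hedge : IsEdge e
        · rw [edgePart, if_pos hedge, h e (Finset.mem_filter.2 ⟨he, hedge⟩)]
        · rw [edgePart, if_neg hedge]
          simpa using (hf e he hedge).symm
    · obtain ⟨hes, hedge⟩ := Finset.mem_filter.1 he
      simp [bondParam, hedge, hf e hes hedge]

/-- The configuration seen from `v`. -/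
def shift (v : V d) (ω : Config d) : Config d := fun e => ω (e.map (· + v))

theorem measurable_shift (v : V d) : Measurable (shift v) :=
  measurable_pi_iff.2 fun _ => measurable_pi_apply _

theorem isEdge_map_add_right (v : V d) (e : Sym2 (V d)) : IsEdge (e.map (· + v)) ↔ IsEdge e := by
  constructor
  · rintro ⟨x, y, h, he⟩
    refine ⟨x - v, y - v, ?_, ?_⟩
    · rw [← latAdj_add_right v]
      simpa using h
    · refine Sym2.map.injective (add_left_injective v) ?_
      simpa using he
  · rintro ⟨x, y, h, rfl⟩
    exact ⟨x + v, y + v, (latAdj_add_right v).2 h, rfl⟩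

theorem measurePreserving_shift (v : V d) :
    MeasurePreserving (shift v) (bondMeasure d p) (bondMeasure d p) where
  measurable := measurable_shift v
  map_eq := by
    refine (Measure.map_infinitePi_infinitePi_of_inj (P := bondLaw p)
      (Sym2.map.injective (add_left_injective v))).trans ?_
    exact congrArg Measure.infinitePi (funext fun e => by
      have h : bondParam p (e.map (· + v)) = bondParam p e := by
        by_cases he : IsEdge e <;> simp [bondParam, isEdge_map_add_right, he]
      rw [bondLaw, bondLaw, h])

theorem openConn_shift {v : V d} {ω : Config d} {x y : V d} :
    openConn (shift v ω) x y ↔ openConn ω (x + v) (y + v) := by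
  constructor
  · exact fun h => ReflTransGen.lift (· + v)
      (fun a b hab => ⟨(latAdj_add_right v).2 hab.1, hab.2⟩) _ _ h
  · intro h
    have := ReflTransGen.lift (p := fun a b => latAdj a b ∧ shift v ω s(a, b) = true) (· - v)
      (fun a b hab => ⟨(latAdj_add_right v).1 (by simpa using hab.1), by
        simpa [shift] using hab.2⟩) _ _ h
    simpa [Function.onFun, openConn] using this

theorem Xset_shift (v : V d) (ω : Config d) : Xset (shift v ω) = {x | x + v ∈ Xset ω} := by
  ext x
  have h : cluster (shift v ω) x = (· + v) ⁻¹' cluster ω (x + v) := by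
    ext y
    exact openConn_shift
  refine not_congr ?_
  unfold inInfCluster
  rw [h, ← Set.infinite_image_iff (f := (· + v)) (add_left_injective v).injOn,
    Set.image_preimage_eq _ (add_right_surjective v)]

theorem exists_shift_disjoint (hd : 0 < d) (s : Finset (Sym2 (V d))) :
    ∃ v : V d, ∀ e ∈ s, e.map (· + v) ∉ s := by
  have : Nonempty (Fin d) := ⟨⟨0, hd⟩⟩
  have hfin : (⋃ e ∈ s, ⋃ e' ∈ s, {v : V d | e.map (· + v) = e'}).Finite := by
    refine s.finite_toSet.biUnion fun e _ => s.finite_toSet.biUnion fun e' _ => ?_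
    induction e using Sym2.ind with
    | _ a b =>
    induction e' using Sym2.ind with
    | _ a' b' =>
    refine ((Set.finite_singleton (b' - a)).insert (a' - a)).subset fun v hv => ?_
    rcases Sym2.eq_iff.1 (hv : s(a + v, b + v) = s(a', b')) with ⟨h, -⟩ | ⟨h, -⟩
    · exact Or.inl (by simp [← h])
    · exact Or.inr (by simp [← h])
  obtain ⟨v, hv⟩ := hfin.infinite_compl.nonempty
  refine ⟨v, fun e he he' => hv ?_⟩
  simp only [mem_iUnion]
  exact ⟨e, he, _, he', rfl⟩

open scoped symmDiff in
/-- Translation-invariant events have probability `0` or `1`. -/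
theorem measure_eq_zero_or_one_of_shift (hd : 0 < d) {A : Set (Config d)} (hA : MeasurableSet A)
    (hinv : ∀ v, shift v ⁻¹' A = A) : bondMeasure d p A = 0 ∨ bondMeasure d p A = 1 := by
  classical
  set Q := bondMeasure d p with hQ
  have key : ∀ ε : ℝ, 0 < ε → |Q.real A - Q.real A * Q.real A| ≤ 4 * ε := by
    intro ε hε
    obtain ⟨C, hC, hCA⟩ := exists_measure_symmDiff_lt_of_generateFrom_isSetRing (μ := Q)
      isSetRing_measurableCylinders
      ⟨{univ}, Set.countable_singleton _, by
        simpa using univ_mem_measurableCylinders (fun _ : Sym2 (V d) => Bool), by simp⟩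
      generateFrom_measurableCylinders.symm hA (ENNReal.ofReal_pos.2 hε)
    have hCm := MeasurableSet.of_mem_measurableCylinders hC
    obtain ⟨s, S, hS, rfl⟩ := (mem_measurableCylinders _).1 hC
    obtain ⟨v, hv⟩ := exists_shift_disjoint hd s
    set C : Set (Config d) := cylinder (α := fun _ => Bool) s S
    have h1 : Q.real (C ∆ A) ≤ ε := ENNReal.toReal_le_of_le_ofReal hε.le hCA.le
    have hmp := measurePreserving_shift (d := d) p v
    have h2 : Q.real ((shift v ⁻¹' C) ∆ A) ≤ ε := by
      have h : (shift v ⁻¹' C) ∆ A = shift v ⁻¹' (C ∆ A) := by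
        conv_lhs => rw [← hinv v]
        rfl
      rw [h, measureReal_def, hmp.measure_preimage (hCm.symmDiff hA).nullMeasurableSet]
      exact h1
    have h2' : Q.real (shift v ⁻¹' C) = Q.real C := by
      rw [measureReal_def, hmp.measure_preimage hCm.nullMeasurableSet, measureReal_def]
    have hind : Q.real (C ∩ shift v ⁻¹' C) = Q.real C * Q.real C := by
      have hdisj : Disjoint s (s.image (Sym2.map (· + v))) :=
        Finset.disjoint_right.2 fun e he => by
          obtain ⟨e, he', rfl⟩ := Finset.mem_image.1 he
          exact hv e he'
      have hindep := (iIndepFun_infinitePi (P := bondLaw (d := d) p) (X := fun _ b => b)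
        fun _ => measurable_id).indepFun_finset s _ hdisj fun e => measurable_pi_apply e
      have hT : MeasurableSet {y : s.image (Sym2.map (· + v)) → Bool |
          (fun e : s => y ⟨_, Finset.mem_image_of_mem (Sym2.map (· + v)) e.2⟩) ∈ S} :=
        (measurable_pi_iff.2 fun e => measurable_pi_apply _) hS
      have := hindep.measure_inter_preimage_eq_mul _ _ hS hT
      nth_rw 2 [← h2']
      rw [measureReal_def, measureReal_def, measureReal_def, ← ENNReal.toReal_mul]
      exact congrArg ENNReal.toReal this
    have h3 : |Q.real (C ∩ shift v ⁻¹' C) - Q.real A| ≤ 2 * ε := by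
      refine (abs_measureReal_sub_le_measureReal_symmDiff
        (hCm.inter (hmp.measurable hCm)).nullMeasurableSet hA.nullMeasurableSet).trans ?_
      refine (measureReal_mono (s₂ := (C ∆ A) ∪ ((shift v ⁻¹' C) ∆ A)) ?_).trans
        ((measureReal_union_le _ _).trans (by linarith))
      intro ω hω
      simp only [mem_symmDiff, mem_inter_iff, mem_union] at hω ⊢
      tauto
    have h4 : |Q.real C - Q.real A| ≤ ε := (abs_measureReal_sub_le_measureReal_symmDiff
      hCm.nullMeasurableSet hA.nullMeasurableSet).trans h1
    have hC0 : 0 ≤ Q.real C := measureReal_nonneg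
    have hC1 : Q.real C ≤ 1 := measureReal_le_one
    have hA0 : 0 ≤ Q.real A := measureReal_nonneg
    have hA1 : Q.real A ≤ 1 := measureReal_le_one
    rw [hind] at h3
    rw [abs_le] at *
    constructor <;> nlinarith
  have h0 : Q.real A - Q.real A * Q.real A = 0 := by
    by_contra hne
    have := key (|Q.real A - Q.real A * Q.real A| / 8) (by positivity)
    have := abs_pos.2 hne
    linarith
  have h0 : Q.real A * (1 - Q.real A) = 0 := by linarith
  rcases mul_eq_zero.1 h0 with h | h
  · exact Or.inl ((measureReal_eq_zero_iff).1 h)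
  · right
    have h : Q.real A = 1 := by linarith
    rw [measureReal_def] at h
    exact (ENNReal.toReal_eq_one_iff _).1 h

end BondMeasure

section BurtonKeane

open ProbabilityTheory unitInterval

variable {d : ℕ} {p : I}

/-- Finite energy: closing finitely many edges preserves null events. -/
theorem measure_closeOn_preimage_eq_zero (hp : p < 1) (U : Finset (V d)) {T : Set (Config d)}
    (hT : MeasurableSet T) (h : bondMeasure d p T = 0) :
    bondMeasure d p (closeOn U ⁻¹' T) = 0 := by
  classical
  set G : Set (Config d) := Set.pi U.sym2 fun _ => {false}
  have hG0 : bondMeasure d p G ≠ 0 := by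
    rw [bondMeasure, Measure.infinitePi_pi _ fun _ _ => measurableSet_singleton _,
      Finset.prod_ne_zero_iff]
    intro e _
    have h1 : (p : ℝ) < 1 := hp
    by_cases he : IsEdge e <;> simp [bondLaw_singleton, bondParam, he, h1]
  let m : Sym2 (V d) → MeasurableSpace (Config d) := fun e =>
    MeasurableSpace.comap (fun ω => ω e) inferInstance
  have hm : ∀ e, Measurable[m e] fun ω : Config d => ω e := fun e => comap_measurable _
  have hind : Indep (⨆ e ∈ {e | e ∈ U.sym2}, m e) (⨆ e ∈ {e | e ∉ U.sym2}, m e)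
      (bondMeasure d p) :=
    indep_iSup_of_disjoint (fun e => (measurable_pi_apply e).comap_le)
      (iIndepFun_infinitePi (P := bondLaw (d := d) p) (X := fun _ b => b)
        fun _ => measurable_id).iIndep
      (Set.disjoint_left.2 fun e he he' => he' he)
  have hGm : MeasurableSet[⨆ e ∈ {e | e ∈ U.sym2}, m e] G := by
    rw [show G = ⋂ e ∈ U.sym2, (fun ω : Config d => ω e) ⁻¹' {false} from Set.pi_def _ _]
    exact @Finset.measurableSet_biInter _ _ (_) _ _ fun e he =>
      le_iSup₂_of_le (f := fun e _ => m e) e he le_rfl _ (hm e (measurableSet_singleton _))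
  have hHm : MeasurableSet[⨆ e ∈ {e | e ∉ U.sym2}, m e] (closeOn U ⁻¹' T) := by
    have : Measurable[⨆ e ∈ {e | e ∉ U.sym2}, m e] (closeOn U) := by
      refine @measurable_pi_iff _ _ _ (_) _ _ |>.2 fun e => ?_
      unfold closeOn
      by_cases he : e ∈ U.sym2
      · simp only [he, if_true]
        exact @measurable_const _ _ _ (_) _
      · simp only [he, if_false]
        exact (hm e).mono (le_iSup₂_of_le (f := fun e _ => m e) e he le_rfl) le_rfl
    exact this hT
  have hsub : G ∩ closeOn U ⁻¹' T ⊆ T := by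
    rintro ω ⟨hG, hω⟩
    have : closeOn U ω = ω := funext fun e => by
      by_cases he : e ∈ U.sym2
      · rw [closeOn, if_pos he, hG e he]
      · rw [closeOn, if_neg he]
    rwa [mem_preimage, this] at hω
  have hprod := (Indep_iff _ _ _).1 hind _ _ hGm hHm
  rw [measure_mono_null hsub h] at hprod
  exact (mul_eq_zero.1 hprod.symm).resolve_left hG0

/-- Almost surely there is no trifurcation at a given place. -/
theorem measure_infTrifurcation (D : Finset (V d)) (a : Fin 3 → V d) :
    bondMeasure d p {ω | InfTrifurcation (Xset ω) D a} = 0 := by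
  classical
  set Q := bondMeasure d p
  set E : Set (Config d) := {ω | InfTrifurcation (Xset ω) D a}
  have hE : MeasurableSet E := measurableSet_infTrifurcation measurableSet_mem_Xset D a
  obtain ⟨m, hm⟩ : ∃ m : ℕ, ∀ x ∈ D ∪ Finset.univ.image a, ∀ i, -(m : ℤ) ≤ x i ∧ x i ≤ m := by
    refine ⟨(D ∪ Finset.univ.image a).sup fun x => Finset.univ.sup fun i => (x i).natAbs,
      fun x hx i => ?_⟩
    have h1 : (x i).natAbs ≤ Finset.univ.sup fun i => (x i).natAbs :=
      Finset.le_sup (f := fun i => (x i).natAbs) (Finset.mem_univ i)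
    have h2 := Finset.le_sup (f := fun x : V d => Finset.univ.sup fun i => (x i).natAbs) hx
    have h3 := h1.trans h2
    omega
  have hsum : ∀ n : ℕ, (n : ENNReal) ^ d * Q E ≤
      ((((2 * m + 1) * n + 2) ^ d - ((2 * m + 1) * n) ^ d : ℕ) : ENNReal) := by
    intro n
    let v : (Fin d → Fin n) → V d := fun k i => (2 * m + 1 : ℤ) * (k i : ℕ)
    calc (n : ENNReal) ^ d * Q E = ∑ k : Fin d → Fin n, Q (shift (v k) ⁻¹' E) := by
          simp [fun k => (measurePreserving_shift p (v k)).measure_preimage hE.nullMeasurableSet, Q]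
      _ = ∑ k : Fin d → Fin n, ∫⁻ ω, (shift (v k) ⁻¹' E).indicator 1 ω ∂Q :=
          Finset.sum_congr rfl fun k _ => (lintegral_indicator_one (measurable_shift _ hE)).symm
      _ = ∫⁻ ω, ∑ k : Fin d → Fin n, (shift (v k) ⁻¹' E).indicator 1 ω ∂Q :=
          (lintegral_finsetSum _ fun k _ =>
            measurable_one.indicator (measurable_shift _ hE)).symm
      _ ≤ ∫⁻ _, ((((2 * m + 1) * n + 2) ^ d - ((2 * m + 1) * n) ^ d : ℕ) : ENNReal) ∂Q := by
          refine lintegral_mono fun ω => ?_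
          simp only [Set.indicator_apply, Pi.one_apply, Finset.sum_boole]
          refine Nat.cast_le.2 (le_of_eq_of_le ?_ (card_infTrifurcation_le (X := Xset ω) D a m n
            (fun x hx => hm x (Finset.mem_union_left _ hx)) fun j => hm _ (by simp)))
          simp only [mem_preimage, E, mem_ofPred_eq, Xset_shift, v]
      _ = _ := by simp
  have hlim : Tendsto (fun n : ℕ => ((2 * m + 1 : ℝ) + 2 / n) ^ d - (2 * m + 1) ^ d) atTop
      (nhds 0) := by
    have := (((tendsto_const_div_atTop_nhds_zero_nat 2).const_add (2 * m + 1 : ℝ)).pow d).sub_const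
      ((2 * m + 1 : ℝ) ^ d)
    simpa using this
  have hle : Q.real E ≤ 0 := by
    refine ge_of_tendsto hlim ((eventually_gt_atTop 0).mono fun n hn => ?_)
    have h := ENNReal.toReal_mono (ENNReal.natCast_ne_top _) (hsum n)
    rw [ENNReal.toReal_mul, ENNReal.toReal_pow, ENNReal.toReal_natCast, ENNReal.toReal_natCast,
      Nat.cast_sub (Nat.pow_le_pow_left (by omega) d)] at h
    push_cast at h
    have hn' : (0 : ℝ) < n := Nat.cast_pos.2 hn
    have h1 : ((2 * m + 1 : ℝ) + 2 / n) * n = (2 * m + 1) * n + 2 := by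
      field_simp
    rw [← h1, mul_pow, mul_pow, ← sub_mul, mul_comm] at h
    exact le_of_mul_le_mul_right h (by positivity)
  exact (measureReal_eq_zero_iff).1 (le_antisymm hle measureReal_nonneg)

/-- Almost surely `X` has no three distinct infinite components. -/
theorem ae_not_three_infComp (hp : p < 1) : ∀ᵐ ω ∂(bondMeasure d p), ∀ x : Fin 3 → V d,
    (∀ j, InfComp (Xset ω) (x j)) → ¬ ∀ j k, connIn (Xset ω) (x j) (x k) → j = k := by
  refine ae_all_iff.2 fun x => ?_
  obtain ⟨B, hxB, -, -, hB⟩ := exists_finset_connIn (mem_univ (x 0)) (Finset.univ.image x)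
    fun z _ => connIn_univ _ _
  obtain ⟨U, hU⟩ := exists_subset_Xset_closeOn B
  have hnull : bondMeasure d p {ω | ∃ D a, InfTrifurcation (Xset ω) D a} = 0 := by
    simp only [ofPred_exists]
    exact measure_iUnion_null fun D => measure_iUnion_null fun a => measure_infTrifurcation D a
  have hmeas : MeasurableSet {ω : Config d | ∃ D a, InfTrifurcation (Xset ω) D a} := by
    simp only [ofPred_exists]
    exact .iUnion fun D => .iUnion fun a =>
      measurableSet_infTrifurcation measurableSet_mem_Xset D a
  filter_upwards [measure_eq_zero_iff_ae_notMem.1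
    (measure_closeOn_preimage_eq_zero hp U hmeas hnull)] with ω hω hinf hsep
  exact hω (exists_trifurcation (Xset_subset_closeOn U ω) (finite_Xset_closeOn_diff U ω) x hinf hsep
    fun j => (hB _ (hxB (by simp))).mono (hU ω))

/-- Almost surely `X` does not have exactly two infinite components, unless it has a unique infinite
component with positive probability. -/
theorem ae_not_two_infComp (hp : p < 1)
    (h : bondMeasure d p {ω | UniqueInfComp (Xset ω)} = 0) :
    ∀ᵐ ω ∂(bondMeasure d p), ∀ x y, InfComp (Xset ω) x →
      ¬ ∀ z, InfComp (Xset ω) z → connIn (Xset ω) x z ∨ connIn (Xset ω) y z := by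
  refine ae_all_iff.2 fun x => ae_all_iff.2 fun y => ?_
  obtain ⟨B, hyB, -, -, hB⟩ := exists_finset_connIn (mem_univ x) {y} fun z _ => connIn_univ _ _
  obtain ⟨U, hU⟩ := exists_subset_Xset_closeOn B
  filter_upwards [measure_eq_zero_iff_ae_notMem.1 (measure_closeOn_preimage_eq_zero hp U
    (measurableSet_uniqueInfComp measurableSet_mem_Xset) h)] with ω hω hinf hall
  exact hω (uniqueInfComp_of_join (Xset_subset_closeOn U ω) (finite_Xset_closeOn_diff U ω) hinf hall
    ((hB y (hyB (by simp))).mono (hU ω)))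

theorem ae_Xset_eq_empty (hd : 0 < d) : ∀ᵐ ω ∂(bondMeasure d 1), Xset ω = ∅ := by
  have hedge : ∀ᵐ ω ∂(bondMeasure d 1), ∀ a b : V d, latAdj a b → ω s(a, b) = true := by
    refine ae_all_iff.2 fun a => ae_all_iff.2 fun b => ?_
    by_cases hab : latAdj a b
    · have h : bondMeasure d 1 ((fun ω => ω s(a, b)) ⁻¹' {false}) = 0 := by
        rw [bondMeasure, (measurePreserving_eval_infinitePi (bondLaw 1) s(a, b)).measure_preimage
          (measurableSet_singleton _).nullMeasurableSet]
        simp [bondLaw_singleton, bondParam, show IsEdge s(a, b) from ⟨a, b, hab, rfl⟩]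
      filter_upwards [measure_eq_zero_iff_ae_notMem.1 h] with ω hω _
      simpa using hω
    · exact .of_forall fun ω h => (hab h).elim
  have : Nonempty (Fin d) := ⟨⟨0, hd⟩⟩
  filter_upwards [hedge] with ω hω
  refine eq_empty_of_forall_notMem fun x hx => hx ?_
  exact Set.infinite_univ.mono fun y _ =>
    ReflTransGen.mono (fun a b hab => ⟨hab.1, hω a b hab.1⟩) _ _ (connIn_univ x y)

theorem ae_not_infComp_or_ae_uniqueInfComp (hd : 0 < d) (p : I) :
    (∀ᵐ ω ∂(bondMeasure d p), ∀ x, ¬ InfComp (Xset ω) x) ∨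
      ∀ᵐ ω ∂(bondMeasure d p), UniqueInfComp (Xset ω) := by
  rcases eq_or_lt_of_le p.2.2 with hp | hp
  · obtain rfl : p = 1 := Subtype.ext hp
    left
    filter_upwards [ae_Xset_eq_empty hd] with ω hω x hx
    exact notMem_empty x (hω ▸ hx.mem)
  have hp : p < 1 := hp
  have hmeas : MeasurableSet {ω : Config d | UniqueInfComp (Xset ω)} :=
    measurableSet_uniqueInfComp measurableSet_mem_Xset
  rcases measure_eq_zero_or_one_of_shift p hd hmeas fun v => by
    ext ω
    simp only [mem_preimage, mem_ofPred_eq, Xset_shift, uniqueInfComp_add_right] with h | h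
  · left
    filter_upwards [ae_not_three_infComp hp, ae_not_two_infComp hp h] with ω h3 h2 x hx
    have h2x := h2 x x hx
    push Not at h2x
    obtain ⟨y, hy, hxy, -⟩ := h2x
    have h2y := h2 x y hx
    push Not at h2y
    obtain ⟨z, hz, hxz, hyz⟩ := h2y
    refine h3 ![x, y, z] (fun j => by fin_cases j <;> assumption) fun j k hjk => ?_
    fin_cases j <;> fin_cases k <;>
      first | rfl | exact absurd hjk ‹_› | exact absurd hjk.symm ‹_›
  · exact Or.inr ((mem_ae_iff_prob_eq_one hmeas).2 h)

theorem IsBernoulli.ae_Xset {P : Measure (Config d)} [IsProbabilityMeasure P]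
    (hP : IsBernoulli P p) {φ : Set (V d) → Prop}
    (h : ∀ᵐ ω ∂(bondMeasure d p), φ (Xset ω)) : P {ω | φ (Xset ω)} = 1 := by
  rw [← map_edgePart hP] at h
  have h := ae_of_ae_map measurable_edgePart.aemeasurable h
  simp only [Xset_edgePart] at h
  exact (measure_congr (eventuallyEq_univ.2 h)).trans measure_univ

end BurtonKeane

/-- Burton–Keane for the complement: the set `X` of vertices in no infinite
open cluster has either a.s. no infinite connected component, or a.s. exactly
one infinite connected component. -/
theorem Xset_unique_infinite_component (d : ℕ) (hd : 2 ≤ d) (p : ℝ)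
    (hp : p ∈ Set.Icc (0 : ℝ) 1)
    (P : Measure (Config d)) [IsProbabilityMeasure P] (hP : IsBernoulli P p) :
    P {ω | ∀ x ∈ Xset ω, (XComp ω x).Finite} = 1 ∨
    P {ω | (∃ x ∈ Xset ω, (XComp ω x).Infinite) ∧
        ∀ x y, x ∈ Xset ω → y ∈ Xset ω →
          (XComp ω x).Infinite → (XComp ω y).Infinite → y ∈ XComp ω x} = 1 := by
  rcases ae_not_infComp_or_ae_uniqueInfComp (by omega : 0 < d) ⟨p, hp⟩ with h | h
  · left
    refine hP.ae_Xset (p := ⟨p, hp⟩) (φ := fun X => ∀ x ∈ X, {y | connIn X x y}.Finite) ?_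
    filter_upwards [h] with ω hω x _
    exact not_infinite.1 (hω x)
  · right
    refine hP.ae_Xset (p := ⟨p, hp⟩) (φ := fun X => (∃ x ∈ X, {y | connIn X x y}.Infinite) ∧
      ∀ x y, x ∈ X → y ∈ X → {z | connIn X x z}.Infinite → {z | connIn X y z}.Infinite →
        connIn X x y) ?_
    filter_upwards [h] with ω ⟨⟨x, hx⟩, hω⟩
    exact ⟨⟨x, hx.mem, hx⟩, fun x y _ _ => hω x y⟩
end

section
/- For the rooted tree T_b (b ≥ 2) in which the root has degree b and every other vertex has degree b+1, the critical value p_fin for the union of finite clusters of bond percolation to contain an infinite component equals (b^{b/(b−1)} − b)/(b^{b/(b−1)} − 1); moreover at p = p_fin the union of finite clusters a.s. has no infinite component. -/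
open Set Relation Filter MeasureTheory

/-- Vertices of the rooted tree `T_b`: finite words over `Fin b`.  The root is
the empty word; every non-root vertex `l` has parent `l.tail`, so the root has
degree `b` and every other vertex has degree `b + 1`. -/
abbrev TVert (b : ℕ) := List (Fin b)

/-- A bond configuration on `T_b`: each non-root vertex `l` carries the state
of the edge joining it to its parent (the value at the root is irrelevant). -/
abbrev TConfig (b : ℕ) := List (Fin b) → Bool

/-- Adjacency in the tree `T_b`. -/
def tAdj {b : ℕ} (x y : TVert b) : Prop :=
  (x ≠ [] ∧ y = x.tail) ∨ (y ≠ [] ∧ x = y.tail)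

/-- One open step in the configuration `ω`. -/
def tOpenAdj {b : ℕ} (ω : TConfig b) (x y : TVert b) : Prop :=
  (x ≠ [] ∧ y = x.tail ∧ ω x = true) ∨ (y ≠ [] ∧ x = y.tail ∧ ω y = true)

/-- The open cluster of `x`. -/
def tCluster {b : ℕ} (ω : TConfig b) (x : TVert b) : Set (TVert b) :=
  {y | ReflTransGen (tOpenAdj ω) x y}

/-- The set `X` of vertices lying in finite open clusters. -/
def tX {b : ℕ} (ω : TConfig b) : Set (TVert b) :=
  {x | (tCluster ω x).Finite}

/-- The connected component of `x` in the subgraph of `T_b` induced on `X`. -/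
def tXComp {b : ℕ} (ω : TConfig b) (x : TVert b) : Set (TVert b) :=
  {y | ReflTransGen (fun a c => tAdj a c ∧ a ∈ tX ω ∧ c ∈ tX ω) x y}

/-- The event that `X` has an infinite connected component. -/
def tXhasInf {b : ℕ} (ω : TConfig b) : Prop :=
  ∃ x ∈ tX ω, (tXComp ω x).Infinite

/-- `P` is the law of i.i.d. Bernoulli(`p`) bond percolation on `T_b`. -/
def IsBernT {b : ℕ} (P : Measure (TConfig b)) (p : ℝ) : Prop :=
  ∀ s : Finset (TVert b), (∀ l ∈ s, l ≠ []) → ∀ f : TVert b → Bool,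
    P {ω | ∀ l ∈ s, ω l = f l} =
      ∏ l ∈ s, ENNReal.ofReal (if f l then p else 1 - p)

/-- The critical value `p_fin(T_b)` for the union of finite clusters to
contain an infinite component. -/
noncomputable def pfinT (b : ℕ) : ℝ :=
  sSup {p | p ∈ Set.Icc (0 : ℝ) 1 ∧ ∀ P : Measure (TConfig b),
    IsBernT P p → IsProbabilityMeasure P → P {ω | tXhasInf ω} ≠ 0}

namespace TreePercolation

variable {b : ℕ}

/-- The configuration seen from `t` on the subtree of its descendants. -/
def shift (t : TVert b) (ω : TConfig b) : TConfig b := fun l => ω (l ++ t)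

@[simp] lemma shift_apply (t l : TVert b) (ω : TConfig b) : shift t ω l = ω (l ++ t) := rfl

@[simp] lemma shift_nil (ω : TConfig b) : shift [] ω = ω := by
  funext l
  simp

lemma shift_shift (s t : TVert b) (ω : TConfig b) :
    shift s (shift t ω) = shift (s ++ t) ω := by
  funext l
  simp

/-- All edges on the path from the root to the given vertex are open. -/
def OpenPath (ω : TConfig b) : TVert b → Prop
  | [] => True
  | a :: y => ω (a :: y) = true ∧ OpenPath ω y

lemma openPath_append_singleton (ω : TConfig b) (y : TVert b) (c : Fin b) :
    OpenPath ω (y ++ [c]) ↔ ω [c] = true ∧ OpenPath (shift [c] ω) y := by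
  induction y with
  | nil => simp [OpenPath]
  | cons a y ih =>
    simp only [List.cons_append, OpenPath, ih, shift_apply]
    tauto

/-- The event that no open path of length `m` descends from the root. -/
def extinctBy : ℕ → Set (TConfig b)
  | 0 => ∅
  | m + 1 => {ω | ∀ c, ω [c] = false ∨ shift [c] ω ∈ extinctBy m}

lemma mem_extinctBy_iff (m : ℕ) (ω : TConfig b) :
    ω ∈ extinctBy m ↔ ∀ y, OpenPath ω y → y.length < m := by
  induction m generalizing ω with
  | zero =>
    simp only [extinctBy, mem_empty_iff_false, Nat.not_lt_zero, imp_false, false_iff, not_forall,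
      not_not]
    exact ⟨[], trivial⟩
  | succ m ih =>
    constructor
    · intro h y hy
      rcases List.eq_nil_or_concat' y with rfl | ⟨y', c, rfl⟩
      · simp
      · rw [openPath_append_singleton] at hy
        rcases h c with h | h
        · simp [hy.1] at h
        · have := (ih _).1 h y' hy.2
          simpa using this
    · intro h c
      by_cases hc : ω [c] = true
      · right
        rw [ih]
        intro y hy
        have := h (y ++ [c]) ((openPath_append_singleton ω y c).2 ⟨hc, hy⟩)
        simpa using this
      · left
        simpa using hc

/-- The event that the open cluster of the root is finite. -/
def extinct (b : ℕ) : Set (TConfig b) := ⋃ m, extinctBy m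

lemma extinctBy_mono : Monotone (extinctBy (b := b)) := by
  intro m n hmn ω
  rw [mem_extinctBy_iff, mem_extinctBy_iff]
  exact fun h y hy => (h y hy).trans_le hmn

lemma finite_iff_length_lt (s : Set (TVert b)) :
    s.Finite ↔ ∃ m, ∀ y ∈ s, y.length < m := by
  constructor
  · intro h
    obtain ⟨m, hm⟩ := (h.image List.length).bddAbove
    exact ⟨m + 1, fun y hy => Nat.lt_succ_of_le (hm ⟨y, hy, rfl⟩)⟩
  · rintro ⟨m, hm⟩
    exact (List.finite_length_lt (Fin b) m).subset hm

lemma mem_extinct_iff (ω : TConfig b) : ω ∈ extinct b ↔ {y | OpenPath ω y}.Finite := by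
  simp [extinct, mem_extinctBy_iff, finite_iff_length_lt]

lemma mem_extinct_iff_forall (ω : TConfig b) :
    ω ∈ extinct b ↔ ∀ c, ω [c] = false ∨ shift [c] ω ∈ extinct b := by
  constructor
  · intro h c
    obtain ⟨m, hm⟩ := mem_iUnion.1 h
    have hm' : ω ∈ extinctBy (m + 1) := extinctBy_mono m.le_succ hm
    exact (hm' c).imp_right fun h => mem_iUnion.2 ⟨m, h⟩
  · intro h
    have hex : ∀ c, ∃ m, ω [c] = false ∨ shift [c] ω ∈ extinctBy m := by
      intro c
      rcases h c with h | h
      · exact ⟨0, Or.inl h⟩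
      · obtain ⟨m, hm⟩ := mem_iUnion.1 h
        exact ⟨m, Or.inr hm⟩
    choose f hf using hex
    refine mem_iUnion.2 ⟨Finset.univ.sup f + 1, fun c => (hf c).imp_right fun h => ?_⟩
    exact extinctBy_mono (Finset.le_sup (Finset.mem_univ c)) h

lemma openPath_append_mem_tCluster {ω : TConfig b} {t y : TVert b}
    (hy : OpenPath (shift t ω) y) : y ++ t ∈ tCluster ω t := by
  induction y with
  | nil => exact ReflTransGen.refl
  | cons a y ih => exact (ih hy.2).tail (Or.inr ⟨by simp, rfl, hy.1⟩)

/-- The cluster of a vertex joined to its ancestor `t` by an open path, where `t` is the root or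
the edge above `t` is closed, consists of vertices joined to `t` in the same way. -/
lemma tCluster_subset {ω : TConfig b} {t y : TVert b} (ht : t = [] ∨ ω t = false)
    (hy : OpenPath (shift t ω) y) :
    tCluster ω (y ++ t) ⊆ (· ++ t) '' {z | OpenPath (shift t ω) z} := by
  intro x hx
  induction hx with
  | refl => exact ⟨y, hy, rfl⟩
  | tail _ hstep ih =>
    obtain ⟨z, hz, rfl⟩ := ih
    rcases hstep with ⟨hne, rfl, hopen⟩ | ⟨hne, heq, hopen⟩
    · cases z with
      | nil =>
        simp only [List.nil_append] at hne hopen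
        simp_all
      | cons a z => exact ⟨z, hz.2, rfl⟩
    · rename_i c _
      cases c with
      | nil => exact absurd rfl hne
      | cons a c =>
        simp only [List.tail_cons] at heq
        subst heq
        exact ⟨a :: z, ⟨hopen, hz⟩, rfl⟩

lemma exists_clusterTop (ω : TConfig b) (y : TVert b) :
    ∃ z t, y = z ++ t ∧ OpenPath (shift t ω) z ∧ (t = [] ∨ ω t = false) := by
  induction y with
  | nil => exact ⟨[], [], rfl, trivial, Or.inl rfl⟩
  | cons a y ih =>
    by_cases h : ω (a :: y) = true
    · obtain ⟨z, t, rfl, hz, ht⟩ := ih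
      exact ⟨a :: z, t, rfl, ⟨h, hz⟩, ht⟩
    · exact ⟨[], a :: y, rfl, trivial, Or.inr (by simpa using h)⟩

/-- Every vertex on the path from the root to the given vertex has finitely many descendants in
its open cluster. -/
def ExtinctPath (ω : TConfig b) : TVert b → Prop
  | [] => ω ∈ extinct b
  | a :: y => shift (a :: y) ω ∈ extinct b ∧ ExtinctPath ω y

lemma ExtinctPath.of_append {ω : TConfig b} {y t : TVert b} (h : ExtinctPath ω (y ++ t)) :
    ExtinctPath ω t := by
  induction y with
  | nil => exact h
  | cons a y ih => exact ih h.2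

lemma ExtinctPath.shift_mem {ω : TConfig b} {y : TVert b} (h : ExtinctPath ω y) :
    shift y ω ∈ extinct b := by
  cases y with
  | nil => simpa [ExtinctPath] using h
  | cons a y => exact h.1

lemma extinctPath_append_singleton (ω : TConfig b) (y : TVert b) (c : Fin b) :
    ExtinctPath ω (y ++ [c]) ↔ ω ∈ extinct b ∧ ExtinctPath (shift [c] ω) y := by
  induction y with
  | nil => simp [ExtinctPath, and_comm]
  | cons a y ih =>
    simp only [List.cons_append, ExtinctPath, ih, shift_shift]
    tauto

lemma ExtinctPath.mem_tX {ω : TConfig b} {y : TVert b} (h : ExtinctPath ω y) : y ∈ tX ω := by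
  obtain ⟨z, t, rfl, hz, ht⟩ := exists_clusterTop ω y
  exact (((mem_extinct_iff _).1 h.of_append.shift_mem).image _).subset (tCluster_subset ht hz)

lemma shift_mem_extinct_of_mem_tX {ω : TConfig b} {y : TVert b} (h : y ∈ tX ω) :
    shift y ω ∈ extinct b := by
  rw [mem_extinct_iff]
  refine Set.Finite.of_finite_image (f := (· ++ y)) (h.subset ?_)
    (List.append_left_injective y).injOn
  rintro _ ⟨z, hz, rfl⟩
  exact openPath_append_mem_tCluster hz

lemma ExtinctPath.mem_tXComp {ω : TConfig b} {y : TVert b} (h : ExtinctPath ω y) :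
    y ∈ tXComp ω [] := by
  induction y with
  | nil => exact ReflTransGen.refl
  | cons a y ih =>
    exact (ih h.2).tail ⟨Or.inr ⟨by simp, rfl⟩, h.2.mem_tX, h.mem_tX⟩

/-- The event that some vertex of depth `n` is reached by a path from the root all of whose
vertices have finitely many descendants in their open cluster. -/
def reaches : ℕ → Set (TConfig b)
  | 0 => extinct b
  | n + 1 => extinct b ∩ {ω | ∃ c, shift [c] ω ∈ reaches n}

lemma mem_reaches_iff (n : ℕ) (ω : TConfig b) :
    ω ∈ reaches n ↔ ∃ y, y.length = n ∧ ExtinctPath ω y := by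
  induction n generalizing ω with
  | zero => simp [reaches, ExtinctPath]
  | succ n ih =>
    simp only [reaches, mem_inter_iff, mem_ofPred_eq, ih]
    constructor
    · rintro ⟨h, c, y, hy, hp⟩
      exact ⟨y ++ [c], by simp [hy], (extinctPath_append_singleton ω y c).2 ⟨h, hp⟩⟩
    · rintro ⟨y, hy, hp⟩
      rcases List.eq_nil_or_concat' y with rfl | ⟨y', c, rfl⟩
      · simp at hy
      · rw [extinctPath_append_singleton] at hp
        exact ⟨hp.1, c, y', by simpa using hy, hp.2⟩

lemma tXhasInf_of_mem_reaches {ω : TConfig b} (h : ∀ n, ω ∈ reaches n) : tXhasInf ω := by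
  have h0 : ExtinctPath ω [] := h 0
  refine ⟨[], h0.mem_tX, fun hfin => ?_⟩
  obtain ⟨m, hm⟩ := (finite_iff_length_lt _).1 hfin
  obtain ⟨y, hy, hp⟩ := (mem_reaches_iff m ω).1 (h m)
  exact (hm y hp.mem_tXComp).ne hy

lemma exists_componentTop {ω : TConfig b} {y : TVert b} (hy : y ∈ tX ω) :
    ∃ z t, y = z ++ t ∧ ExtinctPath (shift t ω) z ∧ (t = [] ∨ t.tail ∉ tX ω) := by
  induction y with
  | nil =>
    exact ⟨[], [], rfl, by simpa [ExtinctPath] using shift_mem_extinct_of_mem_tX hy, Or.inl rfl⟩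
  | cons a y ih =>
    have hs := shift_mem_extinct_of_mem_tX hy
    by_cases h : y ∈ tX ω
    · obtain ⟨z, t, rfl, hz, ht⟩ := ih h
      exact ⟨a :: z, t, rfl, ⟨by simpa [shift_shift] using hs, hz⟩, ht⟩
    · exact ⟨[], a :: y, rfl, hs, Or.inr h⟩

lemma tXComp_subset {ω : TConfig b} {t y : TVert b} (ht : t = [] ∨ t.tail ∉ tX ω)
    (hy : ExtinctPath (shift t ω) y) :
    tXComp ω (y ++ t) ⊆ (· ++ t) '' {z | ExtinctPath (shift t ω) z} := by
  intro x hx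
  induction hx with
  | refl => exact ⟨y, hy, rfl⟩
  | tail _ hstep ih =>
    obtain ⟨z, hz, rfl⟩ := ih
    obtain ⟨⟨hne, rfl⟩ | ⟨hne, heq⟩, -, hc⟩ := hstep
    · cases z with
      | nil =>
        simp only [List.nil_append] at hne hc
        simp_all
      | cons a z => exact ⟨z, hz.2, rfl⟩
    · rename_i c _
      cases c with
      | nil => exact absurd rfl hne
      | cons a c =>
        simp only [List.tail_cons] at heq
        subst heq
        refine ⟨a :: z, ⟨?_, hz⟩, rfl⟩
        simpa [shift_shift] using shift_mem_extinct_of_mem_tX hc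

lemma exists_mem_reaches_of_tXhasInf {ω : TConfig b} (h : tXhasInf ω) :
    ∃ t, ∀ n, shift t ω ∈ reaches n := by
  obtain ⟨x, hx, hinf⟩ := h
  obtain ⟨y, t, rfl, hy, ht⟩ := exists_componentTop hx
  refine ⟨t, fun n => ?_⟩
  have hinf' : {z | ExtinctPath (shift t ω) z}.Infinite :=
    (hinf.mono (tXComp_subset ht hy)).of_image _
  rw [Set.Infinite, finite_iff_length_lt] at hinf'
  push Not at hinf'
  obtain ⟨z, hz, hn⟩ := hinf' n
  rw [mem_reaches_iff]
  refine ⟨z.drop (z.length - n), by simp; omega, ?_⟩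
  rw [mem_ofPred_eq, ← List.take_append_drop (z.length - n) z] at hz
  exact hz.of_append

lemma measurable_shift (t : TVert b) : Measurable (shift (b := b) t) :=
  measurable_pi_lambda _ fun _ => measurable_pi_apply _

lemma measurableSet_apply_eq (l : TVert b) (x : Bool) :
    MeasurableSet {ω : TConfig b | ω l = x} :=
  measurable_pi_apply (X := fun _ : TVert b => Bool) l (measurableSet_singleton x)

lemma measurableSet_extinctBy (m : ℕ) : MeasurableSet (extinctBy (b := b) m) := by
  induction m with
  | zero => exact MeasurableSet.empty
  | succ m ih =>
    have : extinctBy (b := b) (m + 1) =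
        ⋂ c, ({ω | ω [c] = false} ∪ shift [c] ⁻¹' extinctBy m) := by
      ext ω
      simp [extinctBy]
    rw [this]
    exact MeasurableSet.iInter fun c => (measurableSet_apply_eq _ _).union (measurable_shift _ ih)

lemma measurableSet_extinct : MeasurableSet (extinct b) :=
  MeasurableSet.iUnion measurableSet_extinctBy

lemma measurableSet_reaches (n : ℕ) : MeasurableSet (reaches (b := b) n) := by
  induction n with
  | zero => exact measurableSet_extinct
  | succ n ih =>
    have : reaches (b := b) (n + 1) = extinct b ∩ ⋃ c, shift [c] ⁻¹' reaches n := by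
      ext ω
      simp [reaches]
    rw [this]
    exact measurableSet_extinct.inter (MeasurableSet.iUnion fun c => measurable_shift _ ih)

/-- A set of configurations is insensitive to the root when membership does not depend on the
state of the root. -/
def RootFree (A : Set (TConfig b)) : Prop :=
  ∀ ω x, Function.update ω [] x ∈ A ↔ ω ∈ A

lemma shift_singleton_update (c : Fin b) (ω : TConfig b) (x : Bool) :
    shift [c] (Function.update ω [] x) = shift [c] ω := by
  funext l
  simp [shift]

lemma rootFree_extinctBy (m : ℕ) : RootFree (extinctBy (b := b) m) := by
  intro ω x
  cases m with
  | zero => rfl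
  | succ m => simp [extinctBy, shift_singleton_update]

lemma rootFree_extinct : RootFree (extinct b) := fun ω x => by
  simp [extinct, (rootFree_extinctBy _) ω x]

lemma rootFree_reaches (n : ℕ) : RootFree (reaches (b := b) n) := by
  intro ω x
  cases n with
  | zero => exact rootFree_extinct ω x
  | succ n => simp [reaches, shift_singleton_update, rootFree_extinct ω x]

open scoped unitInterval

/-- The Bernoulli measure on `Bool`. -/
noncomputable def coin (p : I) : Measure Bool :=
  ENNReal.ofReal p • Measure.dirac true + ENNReal.ofReal (1 - p) • Measure.dirac false

lemma coin_singleton (p : I) (x : Bool) :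
    coin p {x} = ENNReal.ofReal (if x then (p : ℝ) else 1 - p) := by
  cases x <;> simp [coin]

instance (p : I) : IsProbabilityMeasure (coin p) := by
  constructor
  simp [coin, ← ENNReal.ofReal_add p.2.1 (sub_nonneg.2 p.2.2)]

/-- The law of i.i.d. Bernoulli states at all vertices of `T_b`, the root included. -/
noncomputable def bernoulliLaw (b : ℕ) (p : I) : Measure (TConfig b) :=
  Measure.infinitePi fun _ => coin p

instance (p : I) : IsProbabilityMeasure (bernoulliLaw b p) := by
  unfold bernoulliLaw
  infer_instance

lemma isBernT_bernoulliLaw (p : I) : IsBernT (bernoulliLaw b p) p := by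
  intro s _ f
  have : {ω : TConfig b | ∀ l ∈ s, ω l = f l} = Set.pi s fun l => {f l} := by
    ext ω
    simp [Set.pi]
  rw [this, bernoulliLaw, Measure.infinitePi_pi _ fun _ _ => measurableSet_singleton _]
  simp [coin_singleton]

lemma measurable_update_root :
    Measurable fun z : Bool × TConfig b => Function.update z.2 [] z.1 := by
  refine measurable_pi_lambda _ fun l => ?_
  by_cases hl : l = []
  · subst hl
    simpa using measurable_fst
  · simp only [Function.update_of_ne hl]
    exact (measurable_pi_apply l).comp measurable_snd

/-- Resampling the state of the root turns any Bernoulli percolation into the i.i.d. law. -/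
lemma map_update_root {P : Measure (TConfig b)} [IsProbabilityMeasure P] {p : I}
    (hP : IsBernT P p) :
    ((coin p).prod P).map (fun z => Function.update z.2 [] z.1) = bernoulliLaw b p := by
  refine ((Measure.isProjectiveLimit_infinitePi _).unique fun s => ?_).symm
  refine Measure.ext_of_singleton fun g => ?_
  have hrestrict : Measurable (s.restrict : TConfig b → _) := Finset.measurable_restrict s
  set f : TVert b → Bool := fun l => if h : l ∈ s then g ⟨l, h⟩ else false with hf
  have hset : (s.restrict ∘ fun z : Bool × TConfig b => Function.update z.2 [] z.1) ⁻¹' {g} =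
      {x | [] ∈ s → x = f []} ×ˢ {ω | ∀ l ∈ s.erase [], ω l = f l} := by
    ext ⟨x, ω⟩
    simp only [Function.comp_def, mem_preimage, mem_singleton_iff, funext_iff, mem_prod,
      mem_ofPred_eq, Finset.mem_erase, Finset.restrict, Subtype.forall]
    constructor
    · intro h
      refine ⟨fun h0 => ?_, fun l hl => ?_⟩
      · simpa [hf, h0] using h [] h0
      · simpa [hf, hl.1, hl.2] using h l hl.2
    · rintro ⟨h0, h⟩ l hl
      by_cases hl0 : l = []
      · subst hl0
        simpa [hf, hl] using h0 hl
      · simpa [hf, hl, hl0] using h l ⟨hl0, hl⟩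
  rw [Measure.map_map hrestrict measurable_update_root,
    Measure.map_apply (hrestrict.comp measurable_update_root) (measurableSet_singleton _), hset,
    Measure.prod_prod, hP _ (fun l hl => Finset.ne_of_mem_erase hl), Measure.pi_singleton]
  have hprod : ∏ i : s, coin p {g i} = ∏ l ∈ s, ENNReal.ofReal (if f l then (p : ℝ) else 1 - p) := by
    rw [← Finset.prod_attach s, Finset.univ_eq_attach]
    refine Finset.prod_congr rfl fun i _ => ?_
    simp [coin_singleton, hf]
  rw [hprod]
  by_cases h0 : [] ∈ s
  · rw [← Finset.mul_prod_erase s _ h0, ← coin_singleton]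
    simp [h0]
  · have huniv : {x | [] ∈ s → x = f []} = univ := by
      ext x
      simp [h0]
    rw [huniv, measure_univ, one_mul, Finset.erase_eq_of_notMem h0]

lemma measure_eq_of_rootFree {P : Measure (TConfig b)} [IsProbabilityMeasure P] {p : I}
    (hP : IsBernT P p) {A : Set (TConfig b)} (hA : MeasurableSet A) (hfree : RootFree A) :
    P A = bernoulliLaw b p A := by
  rw [← map_update_root hP, Measure.map_apply measurable_update_root hA]
  have : (fun z : Bool × TConfig b => Function.update z.2 [] z.1) ⁻¹' A = univ ×ˢ A := by
    ext ⟨x, ω⟩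
    simp [hfree ω x]
  rw [this, Measure.prod_prod, measure_univ, one_mul]

lemma bernoulliLaw_root_inter (p : I) {A : Set (TConfig b)} (hA : MeasurableSet A)
    (hfree : RootFree A) (x : Bool) :
    bernoulliLaw b p ({ω | ω [] = x} ∩ A) = coin p {x} * bernoulliLaw b p A := by
  conv_lhs => rw [← map_update_root (isBernT_bernoulliLaw p)]
  rw [Measure.map_apply measurable_update_root ((measurableSet_apply_eq _ _).inter hA)]
  have : (fun z : Bool × TConfig b => Function.update z.2 [] z.1) ⁻¹' ({ω | ω [] = x} ∩ A) =
      {x} ×ˢ A := by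
    ext ⟨y, ω⟩
    simp [hfree ω y]
  rw [this, Measure.prod_prod]

lemma isBernT_map_shift {P : Measure (TConfig b)} {p : ℝ} (hP : IsBernT P p) (t : TVert b) :
    IsBernT (P.map (shift t)) p := by
  intro s hs f
  have hmeas : MeasurableSet {ω : TConfig b | ∀ l ∈ s, ω l = f l} := by
    have : {ω : TConfig b | ∀ l ∈ s, ω l = f l} = ⋂ l ∈ s, {ω | ω l = f l} := by
      ext ω
      simp
    rw [this]
    exact s.measurableSet_biInter fun l _ => measurableSet_apply_eq l _
  rw [Measure.map_apply (measurable_shift t) hmeas]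
  have hinj : Function.Injective fun l : TVert b => l ++ t := List.append_left_injective t
  have h := hP (s.map ⟨_, hinj⟩) (by
    simp only [Finset.mem_map, Function.Embedding.coeFn_mk, forall_exists_index, and_imp]
    rintro _ l hl rfl h
    exact hs l hl (List.append_eq_nil_iff.1 h).1) fun l => f (l.take (l.length - t.length))
  simpa [shift] using h

/-- The subtrees below the children of the root, each with the edge above it, are i.i.d. -/
lemma bernoulliLaw_forall_shift (p : I) {A : Set (TConfig b)} (hA : MeasurableSet A) :
    bernoulliLaw b p {ω | ∀ c, shift [c] ω ∈ A} = bernoulliLaw b p A ^ b := by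
  have hinj : Function.Injective fun z : Fin b × TVert b => z.2 ++ [z.1] := by
    rintro ⟨c, l⟩ ⟨c', l'⟩ h
    simpa [and_comm] using h
  have hmeas : Measurable fun (ω : TConfig b) c => shift [c] ω :=
    measurable_pi_lambda _ fun c => measurable_shift [c]
  have hmap : (bernoulliLaw b p).map (fun ω c => shift [c] ω) =
      Measure.pi fun _ => bernoulliLaw b p := by
    have h := Measure.infinitePi_map_curry fun (_ : Fin b) (_ : TVert b) => coin p
    rw [Measure.infinitePi_eq_pi (ι := Fin b),
      ← Measure.map_infinitePi_infinitePi_of_inj (P := fun _ : TVert b => coin p) hinj,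
      Measure.map_map (MeasurableEquiv.measurable _) (by fun_prop)] at h
    exact h
  have hset : {ω : TConfig b | ∀ c, shift [c] ω ∈ A} =
      (fun ω c => shift [c] ω) ⁻¹' Set.pi univ fun _ => A := by
    ext ω
    simp
  rw [hset, ← Measure.map_apply hmeas (MeasurableSet.univ_pi fun _ => hA), hmap, Measure.pi_pi]
  simp

lemma measureReal_forall_shift (p : I) {A : Set (TConfig b)} (hA : MeasurableSet A) :
    (bernoulliLaw b p).real {ω | ∀ c, shift [c] ω ∈ A} = (bernoulliLaw b p).real A ^ b := by
  simp [measureReal_def, bernoulliLaw_forall_shift p hA]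

lemma measureReal_closed_union (p : I) {A : Set (TConfig b)} (hA : MeasurableSet A)
    (hfree : RootFree A) :
    (bernoulliLaw b p).real ({ω | ω [] = false} ∪ A) = 1 - p + p * (bernoulliLaw b p).real A := by
  have hset : {ω : TConfig b | ω [] = false} ∪ A =
      ({ω | ω [] = false} ∩ univ) ∪ ({ω | ω [] = true} ∩ A) := by
    ext ω
    by_cases h : ω [] = true <;> simp [h]
  have hdisj : Disjoint ({ω : TConfig b | ω [] = false} ∩ univ) ({ω | ω [] = true} ∩ A) := by
    rw [Set.disjoint_left]
    rintro ω ⟨h, -⟩ ⟨h', -⟩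
    simp_all
  rw [hset, measureReal_union hdisj ((measurableSet_apply_eq _ _).inter hA), measureReal_def,
    measureReal_def, bernoulliLaw_root_inter p MeasurableSet.univ (fun _ _ => Iff.rfl),
    bernoulliLaw_root_inter p hA hfree]
  simp [coin_singleton, measureReal_def, ENNReal.toReal_ofReal p.2.1,
    ENNReal.toReal_ofReal (sub_nonneg.2 p.2.2)]

/-- The probability that a child of the root is either separated from the root or has finitely
many descendants in its cluster. -/
noncomputable def childProb (b : ℕ) (p : I) : ℝ :=
  1 - p + p * (bernoulliLaw b p).real (extinct b)

lemma childProb_nonneg (p : I) : 0 ≤ childProb b p :=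
  add_nonneg (sub_nonneg.2 p.2.2) (mul_nonneg p.2.1 measureReal_nonneg)

lemma childProb_le_one (p : I) : childProb b p ≤ 1 := by
  have := mul_le_of_le_one_right p.2.1 (measureReal_le_one (μ := bernoulliLaw b p) (s := extinct b))
  unfold childProb
  linarith

lemma measureReal_extinct (p : I) :
    (bernoulliLaw b p).real (extinct b) = childProb b p ^ b := by
  rw [childProb, ← measureReal_closed_union p measurableSet_extinct rootFree_extinct,
    ← measureReal_forall_shift p ((measurableSet_apply_eq _ _).union measurableSet_extinct)]
  congr 1
  ext ω
  rw [mem_extinct_iff_forall]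
  simp

lemma childProb_eq (p : I) : childProb b p = 1 - p + p * childProb b p ^ b := by
  rw [← measureReal_extinct]
  rfl

/-- The extinction probability is the least fixed point of the generating function. -/
lemma childProb_le (p : I) {s : ℝ} (hs : 0 ≤ s) (h : 1 - p + p * s ^ b ≤ s) :
    childProb b p ≤ s := by
  have hm (m : ℕ) : (bernoulliLaw b p).real (extinctBy m) ≤ s ^ b := by
    induction m with
    | zero => simpa [extinctBy] using pow_nonneg hs b
    | succ m ih =>
      have hset : extinctBy (b := b) (m + 1) =
          {ω | ∀ c, shift [c] ω ∈ {ω | ω [] = false} ∪ extinctBy m} := by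
        ext ω
        simp [extinctBy]
      rw [hset, measureReal_forall_shift p
        ((measurableSet_apply_eq _ _).union (measurableSet_extinctBy m)),
        measureReal_closed_union p (measurableSet_extinctBy m) (rootFree_extinctBy m)]
      have hp := mul_le_mul_of_nonneg_left ih p.2.1
      exact pow_le_pow_left₀ (add_nonneg (sub_nonneg.2 p.2.2) (mul_nonneg p.2.1 measureReal_nonneg))
        (by linarith) b
  have hlim : Tendsto (fun m => (bernoulliLaw b p).real (extinctBy m)) atTop
      (nhds ((bernoulliLaw b p).real (extinct b))) :=
    (ENNReal.tendsto_toReal (measure_ne_top _ _)).comp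
      (tendsto_measure_iUnion_atTop extinctBy_mono)
  have hq := mul_le_mul_of_nonneg_left (le_of_tendsto' hlim hm) p.2.1
  unfold childProb
  linarith

lemma reaches_subset_extinct (n : ℕ) : reaches (b := b) n ⊆ extinct b := by
  cases n with
  | zero => exact subset_rfl
  | succ n => exact inter_subset_left

lemma reaches_antitone : Antitone (reaches (b := b)) := by
  refine antitone_nat_of_succ_le fun n => ?_
  induction n with
  | zero => exact inter_subset_left
  | succ n ih =>
    rintro ω ⟨h, c, hc⟩
    exact ⟨h, c, ih hc⟩

lemma measureReal_reaches_succ (p : I) (n : ℕ) :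
    (bernoulliLaw b p).real (reaches (n + 1)) =
      childProb b p ^ b - (childProb b p - (bernoulliLaw b p).real (reaches n)) ^ b := by
  have hG : MeasurableSet ({ω | ω [] = false} ∪ extinct b) :=
    (measurableSet_apply_eq _ _).union measurableSet_extinct
  have hR := measurableSet_reaches (b := b) n
  have hset : reaches (b := b) (n + 1) =
      extinct b \ {ω | ∀ c, shift [c] ω ∈ ({ω | ω [] = false} ∪ extinct b) \ reaches n} := by
    ext ω
    simp only [reaches, mem_inter_iff, mem_ofPred_eq, Set.mem_sdiff, mem_union, not_forall,
      not_and_or, not_not, and_congr_right_iff]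
    intro h
    refine exists_congr fun c => (or_iff_right ?_).symm
    exact not_not.2 ((mem_extinct_iff_forall ω).1 h c)
  have hsub : {ω | ∀ c, shift [c] ω ∈ ({ω | ω [] = false} ∪ extinct b) \ reaches n} ⊆
      extinct b := by
    intro ω h
    rw [mem_extinct_iff_forall]
    simpa using fun c => (h c).1
  have hmeas : MeasurableSet
      {ω | ∀ c, shift [c] ω ∈ ({ω | ω [] = false} ∪ extinct b) \ reaches n} := by
    have : {ω | ∀ c, shift [c] ω ∈ ({ω | ω [] = false} ∪ extinct b) \ reaches n} =
        ⋂ c, shift [c] ⁻¹' (({ω | ω [] = false} ∪ extinct b) \ reaches n) := by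
      ext ω
      simp
    rw [this]
    exact MeasurableSet.iInter fun c => measurable_shift _ (hG.diff hR)
  rw [hset, measureReal_sdiff hsub hmeas, measureReal_extinct,
    measureReal_forall_shift p (hG.diff hR),
    measureReal_sdiff ((reaches_subset_extinct n).trans subset_union_right) hR,
    measureReal_closed_union p measurableSet_extinct rootFree_extinct]
  rfl

lemma tendsto_measureReal_reaches (p : I) :
    Tendsto (fun n => (bernoulliLaw b p).real (reaches n)) atTop
      (nhds ((bernoulliLaw b p).real (⋂ n, reaches n))) :=
  (ENNReal.tendsto_toReal (measure_ne_top _ _)).comp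
    (tendsto_measure_iInter_atTop (fun n => (measurableSet_reaches n).nullMeasurableSet)
      reaches_antitone ⟨0, measure_ne_top _ _⟩)

lemma pow_sub_mul_lt_pow {s x : ℝ} (hb : 2 ≤ b) (hx : 0 < x) (hxs : x ≤ s) :
    s ^ b - b * s ^ (b - 1) * x < (s - x) ^ b := by
  have hs : 0 < s := hx.trans_le hxs
  have h := one_add_mul_self_lt_rpow_one_add (s := -(x / s)) (p := b)
    (neg_le_neg ((div_le_one hs).2 hxs)) (neg_ne_zero.2 (div_pos hx hs).ne')
    (by exact_mod_cast hb)
  rw [Real.rpow_natCast] at h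
  have h' := mul_lt_mul_of_pos_left h (pow_pos hs b)
  have hr : s ^ b * (1 + -(x / s)) ^ b = (s - x) ^ b := by
    rw [← mul_pow]
    congr 1
    field_simp
    ring
  have hl : s ^ b * (1 + b * -(x / s)) = s ^ b - b * s ^ (b - 1) * x := by
    obtain ⟨n, rfl⟩ : ∃ n, b = n + 1 := ⟨b - 1, by omega⟩
    simp only [Nat.add_sub_cancel, pow_succ]
    field_simp
    ring
  rwa [hr, hl] at h'

lemma bernoulliLaw_iInter_reaches_eq_zero (hb : 2 ≤ b) (p : I)
    (h : b * childProb b p ^ (b - 1) ≤ 1) : bernoulliLaw b p (⋂ n, reaches n) = 0 := by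
  have hlim := tendsto_measureReal_reaches (b := b) p
  set L := (bernoulliLaw b p).real (⋂ n, reaches n) with hL
  have hfix : L = childProb b p ^ b - (childProb b p - L) ^ b := by
    refine tendsto_nhds_unique ((tendsto_add_atTop_iff_nat 1).2 hlim) ?_
    simp only [measureReal_reaches_succ]
    exact ((hlim.const_sub _).pow b).const_sub _
  have hLs : L ≤ childProb b p := by
    calc L ≤ (bernoulliLaw b p).real (extinct b) :=
          measureReal_mono ((iInter_subset _ 0).trans (reaches_subset_extinct 0))
      _ = childProb b p ^ b := measureReal_extinct p
      _ ≤ childProb b p :=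
          pow_le_of_le_one (childProb_nonneg p) (childProb_le_one p) (by omega)
  have hL0 : 0 ≤ L := measureReal_nonneg
  rcases hL0.eq_or_lt with h0 | h0
  · rwa [← h0, eq_comm, measureReal_eq_zero_iff] at hL
  · have h1 := pow_sub_mul_lt_pow hb h0 hLs
    have h2 := mul_le_mul_of_nonneg_right h hL0
    linarith

lemma exists_le_pow_sub {s : ℝ} (hs : 0 < s) (h : 1 < b * s ^ (b - 1)) :
    ∃ x, 0 < x ∧ x ≤ s ^ b ∧ x ≤ s ^ b - (s - x) ^ b := by
  have hderiv : HasDerivAt (fun x : ℝ => s ^ b - (s - x) ^ b) (b * s ^ (b - 1)) 0 := by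
    have := (((hasDerivAt_id (0 : ℝ)).const_sub s).pow b).const_sub (s ^ b)
    simpa using this
  have hslope := (hasDerivAt_iff_tendsto_slope.1 hderiv).eventually (lt_mem_nhds h)
  have hright : nhdsWithin (0 : ℝ) (Ioi 0) ≤ nhdsWithin 0 {0}ᶜ :=
    nhdsWithin_mono _ fun x hx => (mem_Ioi.1 hx).ne'
  obtain ⟨x, hx, hx0, hxs⟩ := ((hslope.filter_mono hright).and
    (Ioc_mem_nhdsGT (pow_pos hs b))).exists
  refine ⟨x, hx0, hxs, ?_⟩
  rw [slope_def_field] at hx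
  simp only [sub_zero, sub_self] at hx
  rw [lt_div_iff₀ hx0] at hx
  linarith

lemma bernoulliLaw_iInter_reaches_ne_zero (hb : 2 ≤ b) (p : I)
    (h : 1 < b * childProb b p ^ (b - 1)) : bernoulliLaw b p (⋂ n, reaches n) ≠ 0 := by
  have hs : 0 < childProb b p := by
    refine (childProb_nonneg p).lt_of_ne fun h0 => ?_
    rw [← h0, zero_pow (by omega)] at h
    norm_num at h
  obtain ⟨x, hx0, hxs, hx⟩ := exists_le_pow_sub hs h
  have hn (n : ℕ) : x ≤ (bernoulliLaw b p).real (reaches n) := by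
    induction n with
    | zero => rwa [reaches, measureReal_extinct]
    | succ n ih =>
      have hle : (bernoulliLaw b p).real (reaches n) ≤ childProb b p := by
        refine (measureReal_mono (reaches_subset_extinct n)).trans ?_
        rw [measureReal_extinct]
        exact pow_le_of_le_one (childProb_nonneg p) (childProb_le_one p) (by omega)
      have := pow_le_pow_left₀ (sub_nonneg.2 hle) (sub_le_sub_left ih (childProb b p)) b
      rw [measureReal_reaches_succ]
      linarith
  intro h0
  have := ge_of_tendsto' (tendsto_measureReal_reaches p) hn
  rw [measureReal_def, h0, ENNReal.toReal_zero] at this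
  linarith

lemma measurableSet_iInter_reaches : MeasurableSet (⋂ n, reaches (b := b) n) :=
  MeasurableSet.iInter measurableSet_reaches

lemma rootFree_iInter_reaches : RootFree (⋂ n, reaches (b := b) n) := fun ω x => by
  simp [(rootFree_reaches _) ω x]

lemma measure_tXhasInf_eq_zero {P : Measure (TConfig b)} [IsProbabilityMeasure P] {p : I}
    (hP : IsBernT P p) (hb : 2 ≤ b) (h : b * childProb b p ^ (b - 1) ≤ 1) :
    P {ω | tXhasInf ω} = 0 := by
  refine measure_mono_null (t := ⋃ t, shift t ⁻¹' ⋂ n, reaches n) (fun ω hω => ?_)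
    (measure_iUnion_null fun t => ?_)
  · simpa using exists_mem_reaches_of_tXhasInf hω
  · have := Measure.isProbabilityMeasure_map (μ := P) (measurable_shift t).aemeasurable
    rw [← Measure.map_apply (measurable_shift t) measurableSet_iInter_reaches,
      measure_eq_of_rootFree (isBernT_map_shift hP t) measurableSet_iInter_reaches
        rootFree_iInter_reaches]
    exact bernoulliLaw_iInter_reaches_eq_zero hb p h

lemma measure_tXhasInf_ne_zero {P : Measure (TConfig b)} [IsProbabilityMeasure P] {p : I}
    (hP : IsBernT P p) (hb : 2 ≤ b) (h : 1 < b * childProb b p ^ (b - 1)) :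
    P {ω | tXhasInf ω} ≠ 0 := by
  intro h0
  refine bernoulliLaw_iInter_reaches_ne_zero hb p h ?_
  rw [← measure_eq_of_rootFree hP measurableSet_iInter_reaches rootFree_iInter_reaches]
  exact measure_mono_null (fun ω hω => tXhasInf_of_mem_reaches (mem_iInter.1 hω)) h0

/-- The value of `childProb` at criticality. -/
noncomputable def critChild (b : ℕ) : ℝ := (b : ℝ) ^ (-1 / ((b : ℝ) - 1))

lemma critChild_pos (hb : 2 ≤ b) : 0 < critChild b :=
  Real.rpow_pos_of_pos (by positivity) _

lemma critChild_lt_one (hb : 2 ≤ b) : critChild b < 1 := by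
  have hb' : (2 : ℝ) ≤ b := by exact_mod_cast hb
  exact Real.rpow_lt_one_of_one_lt_of_neg (by linarith)
    (div_neg_of_neg_of_pos (by norm_num) (by linarith))

lemma mul_critChild_pow (hb : 2 ≤ b) : b * critChild b ^ (b - 1) = 1 := by
  have hb' : (2 : ℝ) ≤ b := by exact_mod_cast hb
  have hne : (b : ℝ) - 1 ≠ 0 := by linarith
  rw [critChild, ← Real.rpow_mul_natCast (by positivity), Nat.cast_sub (by omega), Nat.cast_one,
    div_mul_cancel₀ _ hne, Real.rpow_neg_one, mul_inv_cancel₀ (by positivity)]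

lemma mul_critChild_pow_self (hb : 2 ≤ b) : b * critChild b ^ b = critChild b := by
  obtain ⟨n, rfl⟩ : ∃ n, b = n + 1 := ⟨b - 1, by omega⟩
  have := mul_critChild_pow hb
  rw [Nat.add_sub_cancel] at this
  rw [pow_succ, ← mul_assoc, this, one_mul]

lemma critChild_pow (hb : 2 ≤ b) :
    critChild b ^ b = ((b : ℝ) ^ ((b : ℝ) / ((b : ℝ) - 1)))⁻¹ := by
  rw [critChild, ← Real.rpow_mul_natCast (by positivity), ← Real.rpow_neg (by positivity)]
  congr 1
  ring

lemma critChild_pow_lt (hb : 2 ≤ b) : critChild b ^ b < critChild b :=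
  pow_lt_self_of_lt_one₀ (critChild_pos hb) (critChild_lt_one hb) (by omega)

lemma pfin_formula_eq (hb : 2 ≤ b) :
    ((b : ℝ) ^ ((b : ℝ) / ((b : ℝ) - 1)) - b) / ((b : ℝ) ^ ((b : ℝ) / ((b : ℝ) - 1)) - 1) =
      (1 - critChild b) / (1 - critChild b ^ b) := by
  have hB : (b : ℝ) ^ ((b : ℝ) / ((b : ℝ) - 1)) = (critChild b ^ b)⁻¹ := by
    rw [critChild_pow hb, inv_inv]
  have h0 := pow_pos (critChild_pos hb) b
  have h1 := mul_critChild_pow_self hb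
  rw [hB, ← mul_div_mul_left _ _ h0.ne', mul_sub, mul_sub, mul_inv_cancel₀ h0.ne', mul_one,
    mul_comm _ (b : ℝ), h1]

lemma childProb_le_critChild (hb : 2 ≤ b) {p : I}
    (hp : (1 - critChild b) / (1 - critChild b ^ b) ≤ p) : childProb b p ≤ critChild b := by
  refine childProb_le p (critChild_pos hb).le ?_
  rw [div_le_iff₀ (by linarith [critChild_pow_lt hb, critChild_lt_one hb])] at hp
  linarith

lemma critChild_lt_childProb (hb : 2 ≤ b) {p : I}
    (hp : p < (1 - critChild b) / (1 - critChild b ^ b)) : critChild b < childProb b p := by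
  by_contra! hle
  have h1 := critChild_lt_one hb
  rw [lt_div_iff₀ (by linarith [critChild_pow_lt hb])] at hp
  have hs := childProb_eq (b := b) p
  set s := childProb b p
  have hs1 : 0 < 1 - s := by linarith
  have hconv := (convexOn_pow b).2 (childProb_nonneg p : (0 : ℝ) ≤ s) (zero_le_one : (0 : ℝ) ≤ 1)
    (div_nonneg (sub_nonneg.2 h1.le) hs1.le) (div_nonneg (sub_nonneg.2 hle) hs1.le)
    (by field_simp; ring)
  simp only [smul_eq_mul, one_pow, mul_one] at hconv
  have hcomb : (1 - critChild b) / (1 - s) * s + (critChild b - s) / (1 - s) = critChild b := by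
    field_simp
    ring
  rw [hcomb, div_mul_eq_mul_div, ← add_div, le_div_iff₀ hs1] at hconv
  have hm := mul_le_mul_of_nonneg_left hconv p.2.1
  nlinarith

lemma mul_childProb_pow_le_one (hb : 2 ≤ b) {p : I}
    (hp : (1 - critChild b) / (1 - critChild b ^ b) ≤ p) : b * childProb b p ^ (b - 1) ≤ 1 := by
  rw [← mul_critChild_pow hb]
  gcongr
  · exact childProb_nonneg p
  · exact childProb_le_critChild hb hp

lemma one_lt_mul_childProb_pow (hb : 2 ≤ b) {p : I}
    (hp : p < (1 - critChild b) / (1 - critChild b ^ b)) : 1 < b * childProb b p ^ (b - 1) := by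
  rw [← mul_critChild_pow hb]
  exact mul_lt_mul_of_pos_left (pow_lt_pow_left₀ (critChild_lt_childProb hb hp)
    (critChild_pos hb).le (by omega)) (by positivity)

lemma pfinT_eq (hb : 2 ≤ b) : pfinT b = (1 - critChild b) / (1 - critChild b ^ b) := by
  have h1 := critChild_lt_one hb
  have h2 := critChild_pow_lt hb
  set c := (1 - critChild b) / (1 - critChild b ^ b) with hc
  have hc0 : 0 < c := div_pos (by linarith) (by linarith)
  have hc1 : c ≤ 1 := (div_le_one (by linarith)).2 (by linarith)
  have hset : {p | p ∈ Set.Icc (0 : ℝ) 1 ∧ ∀ P : Measure (TConfig b),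
      IsBernT P p → IsProbabilityMeasure P → P {ω | tXhasInf ω} ≠ 0} = Ico 0 c := by
    ext p
    constructor
    · rintro ⟨hp, h⟩
      refine ⟨hp.1, not_le.1 fun hcp => ?_⟩
      exact h _ (isBernT_bernoulliLaw ⟨p, hp⟩) inferInstance
        (measure_tXhasInf_eq_zero (isBernT_bernoulliLaw ⟨p, hp⟩) hb
          (mul_childProb_pow_le_one hb hcp))
    · intro hp
      have hpI : p ∈ I := ⟨hp.1, hp.2.le.trans hc1⟩
      refine ⟨hpI, fun P hP _ => ?_⟩
      exact measure_tXhasInf_ne_zero (p := ⟨p, hpI⟩) hP hb (one_lt_mul_childProb_pow hb hp.2)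
  rw [pfinT, hset, csSup_Ico hc0]

end TreePercolation

/-- For the rooted tree `T_b` (`b ≥ 2`):
`p_fin = (b^{b/(b-1)} - b)/(b^{b/(b-1)} - 1)`, and at `p = p_fin` the union of
finite clusters a.s. has no infinite component. -/
theorem pfinT_formula (b : ℕ) (hb : 2 ≤ b) :
    pfinT b =
      ((b : ℝ) ^ ((b : ℝ) / ((b : ℝ) - 1)) - b) /
        ((b : ℝ) ^ ((b : ℝ) / ((b : ℝ) - 1)) - 1) ∧
    ∀ P : Measure (TConfig b), IsBernT P (pfinT b) → IsProbabilityMeasure P →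
      P {ω | tXhasInf ω} = 0 := by
  refine ⟨by rw [TreePercolation.pfinT_eq hb, TreePercolation.pfin_formula_eq hb],
    fun P hP _ => ?_⟩
  have h1 := TreePercolation.critChild_lt_one hb
  have h2 := TreePercolation.critChild_pow_lt hb
  have hp : pfinT b ∈ Icc (0 : ℝ) 1 := by
    rw [TreePercolation.pfinT_eq hb]
    exact ⟨div_nonneg (by linarith) (by linarith), (div_le_one (by linarith)).2 (by linarith)⟩
  exact TreePercolation.measure_tXhasInf_eq_zero (p := ⟨pfinT b, hp⟩) hP hb
    (TreePercolation.mul_childProb_pow_le_one hb (TreePercolation.pfinT_eq hb).ge)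
end

section
/- In particular, for the binary-branching rooted tree T_2 (root of degree 2, all other vertices of degree 3), p_fin(T_2) = 2/3, and p_fin(T_b) = (1+o(1)) (log b)/b as b → ∞. -/
open Set Relation Filter MeasureTheory

/-- The open cluster of `v` inside its subtree of descendants stops before depth `k`. -/
def DiesBy {b : ℕ} (ω : TConfig b) : ℕ → TVert b → Prop
  | 0, _ => False
  | k + 1, v => ∀ c, ω (c :: v) = true → DiesBy ω k (c :: v)

/-- The open cluster of `v` inside its subtree of descendants is finite. -/
def Dies {b : ℕ} (ω : TConfig b) (v : TVert b) : Prop := ∃ k, DiesBy ω k v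

/-- Some descending path of length `n` from `v` consists of vertices satisfying `Dies`. -/
def DyingPath {b : ℕ} (ω : TConfig b) : ℕ → TVert b → Prop
  | 0, v => Dies ω v
  | n + 1, v => Dies ω v ∧ ∃ c, DyingPath ω n (c :: v)

/-- One open step away from the root. -/
def OpenDown {b : ℕ} (ω : TConfig b) (x y : TVert b) : Prop :=
  y ≠ [] ∧ x = y.tail ∧ ω y = true

/-- One step away from the root between vertices satisfying `Dies`. -/
def DyingDown {b : ℕ} (ω : TConfig b) (x y : TVert b) : Prop :=
  y ≠ [] ∧ x = y.tail ∧ Dies ω x ∧ Dies ω y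

section Deterministic

variable {b : ℕ} {ω : TConfig b}

theorem DiesBy.succ : ∀ {k : ℕ} {v : TVert b}, DiesBy ω k v → DiesBy ω (k + 1) v
  | 0, _, h => h.elim
  | _ + 1, _, h => fun c hc => (h c hc).succ

theorem DiesBy.mono {v : TVert b} {k m : ℕ} (hkm : k ≤ m) (h : DiesBy ω k v) :
    DiesBy ω m v := by
  induction hkm with
  | refl => exact h
  | step _ ih => exact ih.succ

theorem dies_iff {v : TVert b} : Dies ω v ↔ ∀ c, ω (c :: v) = true → Dies ω (c :: v) := by
  constructor
  · rintro ⟨_ | k, h⟩ c hc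
    · exact h.elim
    · exact ⟨k, h c hc⟩
  · intro h
    have : ∀ c, ∃ k, ω (c :: v) = true → DiesBy ω k (c :: v) := fun c => by
      by_cases hc : ω (c :: v) = true
      · obtain ⟨k, hk⟩ := h c hc
        exact ⟨k, fun _ => hk⟩
      · exact ⟨0, fun h => (hc h).elim⟩
    choose k hk using this
    exact ⟨Finset.univ.sup k + 1, fun c hc =>
      (hk c hc).mono (Finset.le_sup (f := k) (Finset.mem_univ c))⟩

theorem DyingPath.dies {n : ℕ} {v : TVert b} (h : DyingPath ω n v) : Dies ω v := by
  cases n with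
  | zero => exact h
  | succ n => exact h.1

theorem DyingPath.of_succ :
    ∀ {n : ℕ} {v : TVert b}, DyingPath ω (n + 1) v → DyingPath ω n v
  | 0, _, h => h.1
  | _ + 1, _, ⟨h, c, hc⟩ => ⟨h, c, hc.of_succ⟩

theorem finite_of_length_le {S : Set (TVert b)} {N : ℕ} (h : ∀ y ∈ S, y.length ≤ N) :
    S.Finite :=
  (List.finite_length_le (Fin b) N).subset h

theorem exists_length_le_of_finite {S : Set (TVert b)} (h : S.Finite) :
    ∃ N, ∀ y ∈ S, y.length ≤ N := by
  obtain ⟨N, hN⟩ := (h.image List.length).bddAbove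
  exact ⟨N, fun y hy => hN ⟨y, hy, rfl⟩⟩

theorem length_lt_of_diesBy {v y : TVert b} (h : ReflTransGen (OpenDown ω) v y) :
    ∀ {k : ℕ}, DiesBy ω k v → y.length < v.length + k := by
  induction h using ReflTransGen.head_induction_on with
  | refl =>
    rintro (_ | k) h
    · exact h.elim
    · omega
  | @head v z hvz _ ih =>
    rintro (_ | k) h
    · exact h.elim
    · obtain ⟨hz, rfl, hω⟩ := hvz
      cases z with
      | nil => exact (hz rfl).elim
      | cons c z =>
        have := ih (h c hω)
        simp only [List.tail_cons, List.length_cons] at this ⊢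
        omega

theorem exists_deep_of_not_diesBy {k : ℕ} : ∀ {v : TVert b}, ¬ DiesBy ω k v →
    ∃ y, ReflTransGen (OpenDown ω) v y ∧ y.length = v.length + k := by
  induction k with
  | zero => exact fun {v} _ => ⟨v, .refl, rfl⟩
  | succ k ih =>
    intro v h
    simp only [DiesBy, not_forall] at h
    obtain ⟨c, hc, h⟩ := h
    obtain ⟨y, hy, hl⟩ := ih h
    exact ⟨y, .head ⟨by simp, rfl, hc⟩ hy, by simp at hl; omega⟩

theorem openDown_of_mem_tCluster {v y : TVert b} (hv : v = [] ∨ ω v ≠ true)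
    (h : y ∈ tCluster ω v) : ReflTransGen (OpenDown ω) v y := by
  induction h with
  | refl => exact .refl
  | @tail y z _ hyz ih =>
    rcases hyz with ⟨hy, rfl, hω⟩ | hyz
    · rcases ReflTransGen.cases_tail ih with rfl | ⟨u, hu, -, rfl, -⟩
      · exact (hv.elim hy fun h => h hω).elim
      · exact hu
    · exact ih.tail hyz

theorem mem_tX_of_dies {v : TVert b} (hv : v = [] ∨ ω v ≠ true) (h : Dies ω v) :
    v ∈ tX ω := by
  obtain ⟨k, hk⟩ := h
  exact finite_of_length_le fun y hy =>
    (length_lt_of_diesBy (openDown_of_mem_tCluster hv hy) hk).le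

theorem dies_of_mem_tX {v : TVert b} (h : v ∈ tX ω) : Dies ω v := by
  obtain ⟨N, hN⟩ := exists_length_le_of_finite h
  by_contra hd
  obtain ⟨y, hy, hl⟩ := exists_deep_of_not_diesBy fun hk => hd ⟨N + 1, hk⟩
  have := hN y (ReflTransGen.mono (fun _ _ h => Or.inr h) _ _ hy)
  omega

theorem cons_mem_tX {v : TVert b} {c : Fin b} (hv : v ∈ tX ω) (h : Dies ω (c :: v)) :
    c :: v ∈ tX ω := by
  by_cases hω : ω (c :: v) = true
  · exact Set.Finite.subset hv fun y hy =>
      ReflTransGen.head (Or.inr ⟨by simp, rfl, hω⟩) hy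
  · exact mem_tX_of_dies (.inr hω) h

theorem DyingPath.exists_mem_tXComp {n : ℕ} : ∀ {v : TVert b}, v ∈ tX ω → DyingPath ω n v →
    ∃ y ∈ tXComp ω v, y.length = v.length + n := by
  induction n with
  | zero => exact fun {v} _ _ => ⟨v, .refl, rfl⟩
  | succ n ih =>
    rintro v hv ⟨-, c, hc⟩
    have hcv := cons_mem_tX hv hc.dies
    obtain ⟨y, hy, hl⟩ := ih hcv hc
    exact ⟨y, .head ⟨.inr ⟨by simp, rfl⟩, hv, hcv⟩ hy, by simp at hl; omega⟩

theorem tXhasInf_of_dyingPath (h : ∀ n, DyingPath ω n []) : tXhasInf ω := by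
  have h0 : [] ∈ tX ω := mem_tX_of_dies (.inl rfl) (h 0)
  refine ⟨[], h0, fun hfin => ?_⟩
  obtain ⟨N, hN⟩ := exists_length_le_of_finite hfin
  obtain ⟨y, hy, hl⟩ := (h (N + 1)).exists_mem_tXComp h0
  have := hN y hy
  simp at hl
  omega

theorem dyingPath_of_dyingDown {t y : TVert b} (hy : Dies ω y)
    (h : ReflTransGen (DyingDown ω) t y) :
    ∀ {n : ℕ}, t.length + n ≤ y.length → DyingPath ω n t := by
  induction h using ReflTransGen.head_induction_on with
  | refl =>
    intro n hn
    obtain rfl : n = 0 := by omega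
    exact hy
  | @head t z htz _ ih =>
    obtain ⟨hz, rfl, ht, -⟩ := htz
    rintro (_ | n) hn
    · exact ht
    · cases z with
      | nil => exact (hz rfl).elim
      | cons c z =>
        exact ⟨ht, c, ih (by simp only [List.tail_cons, List.length_cons] at hn ⊢; omega)⟩

theorem mem_tX_of_mem_tXComp {x y : TVert b} (hx : x ∈ tX ω) (h : y ∈ tXComp ω x) :
    y ∈ tX ω := by
  rcases ReflTransGen.cases_tail h with rfl | ⟨_, _, -, -, h⟩
  · exact hx
  · exact h

theorem exists_dyingPath_of_tXhasInf (h : tXhasInf ω) : ∃ t, ∀ n, DyingPath ω n t := by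
  obtain ⟨x, hx, hinf⟩ := h
  have hne : (tXComp ω x).Nonempty := ⟨x, .refl⟩
  set t := Function.argminOn List.length (tXComp ω x) hne
  have ht : t ∈ tXComp ω x := Function.argminOn_mem _ _ _
  have hmin : ∀ y ∈ tXComp ω x, t.length ≤ y.length := fun y hy =>
    Function.argminOn_le List.length (tXComp ω x) hy
  have hsymm : Std.Symm fun a c : TVert b => tAdj a c ∧ a ∈ tX ω ∧ c ∈ tX ω :=
    ⟨fun a c ⟨h, ha, hc⟩ => ⟨h.symm, hc, ha⟩⟩
  have hdown : ∀ y ∈ tXComp ω t, ReflTransGen (DyingDown ω) t y := by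
    intro y hy
    induction hy with
    | refl => exact .refl
    | @tail y z hy hyz ih =>
      obtain ⟨hyz | hyz, hyX, hzX⟩ := id hyz
      · obtain ⟨hy0, rfl⟩ := hyz
        rcases ReflTransGen.cases_tail ih with heq | ⟨u, hu, -, rfl, -⟩
        · have := hmin y.tail (ReflTransGen.trans ht (hy.tail hyz))
          have := List.length_pos_iff.2 hy0
          have := congrArg List.length heq
          simp only [List.length_tail] at *
          omega
        · exact hu
      · exact ih.tail ⟨hyz.1, hyz.2, dies_of_mem_tX hyX, dies_of_mem_tX hzX⟩
  refine ⟨t, fun n => ?_⟩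
  by_contra hn
  refine hinf (finite_of_length_le (N := t.length + n) fun y hy => ?_)
  by_contra! hlt
  exact hn (dyingPath_of_dyingDown (dies_of_mem_tX (mem_tX_of_mem_tXComp hx hy))
    (hdown y (ReflTransGen.trans (ReflTransGen.stdSymm.symm _ _ ht) hy)) hlt.le)

end Deterministic

/-- The event that the edge above `l` is open (the whole space when `l` is the root). -/
def edgeOpen {b : ℕ} (l : TVert b) : Set (TConfig b) := {ω | l = [] ∨ ω l = true}

/-- The σ-algebra generated by the states of the edges above the vertices in `S`. -/
@[reducible] def edgeSigma {b : ℕ} (S : Set (TVert b)) : MeasurableSpace (TConfig b) :=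
  ⨆ l ∈ S, MeasurableSpace.generateFrom {edgeOpen l}

/-- The proper descendants of `v`. -/
def below {b : ℕ} (v : TVert b) : Set (TVert b) := {l | v <:+ l ∧ v ≠ l}

/-- The event that `v` has a finite open cluster inside its subtree, or is disconnected from its
parent. -/
def diesOrClosed {b : ℕ} (v : TVert b) : Set (TConfig b) := {ω | ω v = true → Dies ω v}

section Measurability

variable {b : ℕ}

theorem measurableSet_edgeOpen (l : TVert b) : MeasurableSet (edgeOpen l) := by
  have h : MeasurableSet {ω : TConfig b | ω l = true} :=
    (measurable_pi_apply (X := fun _ : TVert b => Bool) l) (MeasurableSet.singleton true)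
  by_cases hl : l = []
  · simp [edgeOpen, hl]
  · simpa [edgeOpen, hl] using h

theorem generateFrom_edgeOpen_le (l : TVert b) :
    MeasurableSpace.generateFrom {edgeOpen l} ≤ (inferInstance : MeasurableSpace (TConfig b)) :=
  MeasurableSpace.generateFrom_le fun s hs => by
    rw [Set.mem_singleton_iff.1 hs]
    exact measurableSet_edgeOpen l

theorem edgeSigma_le (S : Set (TVert b)) :
    edgeSigma S ≤ (inferInstance : MeasurableSpace (TConfig b)) :=
  iSup₂_le fun l _ => generateFrom_edgeOpen_le l

theorem edgeSigma_mono {S T : Set (TVert b)} (h : S ⊆ T) : edgeSigma S ≤ edgeSigma T :=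
  biSup_mono h

theorem measurableSet_edgeSigma_edgeOpen {S : Set (TVert b)} {l : TVert b} (h : l ∈ S) :
    MeasurableSet[edgeSigma S] (edgeOpen l) :=
  le_iSup₂ (f := fun l (_ : l ∈ S) => MeasurableSpace.generateFrom {edgeOpen l}) l h _
    (MeasurableSpace.measurableSet_generateFrom rfl)

theorem cons_mem_below (v : TVert b) (c : Fin b) : c :: v ∈ below v :=
  ⟨List.suffix_cons c v, fun h => by simpa using congrArg List.length h⟩

theorem suffix_cons_subset_below (v : TVert b) (c : Fin b) : {l | c :: v <:+ l} ⊆ below v :=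
  fun l hl => ⟨(List.suffix_cons c v).trans hl, fun h => by
    have := (show c :: v <:+ l from hl).length_le
    rw [← h] at this
    simp at this⟩

theorem below_subset_suffix (v : TVert b) : below v ⊆ {l | v <:+ l} := fun _ h => h.1

theorem setOf_open_imp {v : TVert b} (hv : v ≠ []) (Q : TConfig b → Prop) :
    {ω | ω v = true → Q ω} = (edgeOpen v)ᶜ ∪ {ω | Q ω} := by
  ext ω
  simp [edgeOpen, hv, imp_iff_not_or]

theorem measurableSet_diesBy (k : ℕ) : ∀ v : TVert b,
    MeasurableSet[edgeSigma (below v)] {ω | DiesBy ω k v} := by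
  induction k with
  | zero => exact fun v => @MeasurableSet.empty _ (edgeSigma (below v))
  | succ k ih =>
    intro v
    simp only [DiesBy, Set.ofPred_forall]
    refine MeasurableSet.iInter fun c => ?_
    have := setOf_open_imp (List.cons_ne_nil c v) fun ω => DiesBy ω k (c :: v)
    rw [this]
    exact (measurableSet_edgeSigma_edgeOpen (cons_mem_below v c)).compl.union
      (edgeSigma_mono ((below_subset_suffix _).trans (suffix_cons_subset_below v c)) _ (ih _))

theorem measurableSet_dies (v : TVert b) : MeasurableSet[edgeSigma (below v)] {ω | Dies ω v} := by
  simp only [Dies, Set.ofPred_exists]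
  exact MeasurableSet.iUnion fun k => measurableSet_diesBy k v

theorem measurableSet_dyingPath (n : ℕ) : ∀ v : TVert b,
    MeasurableSet[edgeSigma (below v)] {ω | DyingPath ω n v} := by
  induction n with
  | zero => exact fun v => measurableSet_dies v
  | succ n ih =>
    intro v
    simp only [DyingPath, Set.ofPred_and, Set.ofPred_exists]
    exact (measurableSet_dies v).inter (MeasurableSet.iUnion fun c =>
      edgeSigma_mono ((below_subset_suffix _).trans (suffix_cons_subset_below v c)) _ (ih _))

theorem measurableSet_diesOrClosed {v : TVert b} (hv : v ≠ []) :
    MeasurableSet[edgeSigma {l | v <:+ l}] (diesOrClosed v) := by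
  rw [diesOrClosed, setOf_open_imp hv]
  exact (measurableSet_edgeSigma_edgeOpen (List.suffix_refl v)).compl.union
    (edgeSigma_mono (below_subset_suffix v) _ (measurableSet_dies v))

end Measurability

section Probability

open ProbabilityTheory

variable {b : ℕ} {P : Measure (TConfig b)} {p : ℝ}

theorem IsBernT.measure_biInter_edgeOpen (hP : IsBernT P p) (s : Finset (TVert b)) :
    P (⋂ l ∈ s, edgeOpen l) = ∏ l ∈ s, if l = [] then 1 else ENNReal.ofReal p := by
  have := hP (s.filter (· ≠ [])) (by simp) fun _ => true
  rw [Finset.prod_filter] at this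
  convert this using 2
  · ext ω
    simp [edgeOpen, imp_iff_not_or, or_assoc]
  · split_ifs <;> simp_all

theorem IsBernT.measure_edgeOpen (hP : IsBernT P p) {l : TVert b} (hl : l ≠ []) :
    P (edgeOpen l) = ENNReal.ofReal p := by
  simpa [hl] using hP.measure_biInter_edgeOpen {l}

theorem IsBernT.iIndepSet_edgeOpen (hP : IsBernT P p) :
    iIndepSet (edgeOpen : TVert b → Set (TConfig b)) P := by
  rw [iIndepSet_iff_meas_biInter measurableSet_edgeOpen]
  intro s
  rw [hP.measure_biInter_edgeOpen]
  refine Finset.prod_congr rfl fun l _ => ?_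
  simpa using (hP.measure_biInter_edgeOpen {l}).symm

theorem IsBernT.real_inter (hP : IsBernT P p) {S T : Set (TVert b)} (hST : Disjoint S T)
    {A B : Set (TConfig b)} (hA : MeasurableSet[edgeSigma S] A)
    (hB : MeasurableSet[edgeSigma T] B) : P.real (A ∩ B) = P.real A * P.real B := by
  have h := indep_iSup_of_disjoint generateFrom_edgeOpen_le
    ((iIndepSet_iff_iIndep _ _).1 hP.iIndepSet_edgeOpen) hST
  rw [Indep_iff] at h
  simp [Measure.real, h A B hA hB]

variable [IsProbabilityMeasure P]

theorem IsBernT.real_iInter_children (hP : IsBernT P p) (v : TVert b)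
    {E : Fin b → Set (TConfig b)}
    (hE : ∀ c, MeasurableSet[edgeSigma {l | c :: v <:+ l}] (E c)) :
    P.real (⋂ c, E c) = ∏ c, P.real (E c) := by
  suffices ∀ s : Finset (Fin b), P.real (⋂ c ∈ s, E c) = ∏ c ∈ s, P.real (E c) by
    simpa using this Finset.univ
  intro s
  induction s using Finset.induction_on with
  | empty => simp
  | insert c s hc ih =>
    rw [Finset.set_biInter_insert, Finset.prod_insert hc, ← ih]
    refine hP.real_inter (T := ⋃ d ∈ s, {l | d :: v <:+ l}) ?_ (hE c) ?_
    · rw [Set.disjoint_iUnion₂_right]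
      refine fun d hd => Set.disjoint_left.2 fun l hcl hdl => ?_
      have := (List.suffix_of_suffix_length_le hcl hdl (by simp)).eq_of_length (by simp)
      simp only [List.cons.injEq, and_true] at this
      exact hc (this ▸ hd)
    · exact Finset.measurableSet_biInter s fun d hd =>
        edgeSigma_mono (Set.subset_biUnion_of_mem (u := fun d => {l | d :: v <:+ l}) hd) _ (hE d)

theorem IsBernT.real_open_imp (hP : IsBernT P p) (hp : 0 ≤ p) {v : TVert b} (hv : v ≠ [])
    {Q : TConfig b → Prop} (hQ : MeasurableSet[edgeSigma (below v)] {ω | Q ω}) :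
    P.real {ω | ω v = true → Q ω} = 1 - p + p * P.real {ω | Q ω} := by
  have hQ' := edgeSigma_le _ _ hQ
  have hset : {ω | ω v = true → Q ω} = (edgeOpen v ∩ {ω | Q ω}ᶜ)ᶜ := by
    rw [setOf_open_imp hv, Set.compl_inter, compl_compl]
  rw [hset, probReal_compl_eq_one_sub ((measurableSet_edgeOpen v).inter hQ'.compl),
    hP.real_inter (S := {v}) (T := below v) (by simp [below])
      (measurableSet_edgeSigma_edgeOpen rfl) hQ.compl, probReal_compl_eq_one_sub hQ',
    Measure.real, hP.measure_edgeOpen hv, ENNReal.toReal_ofReal hp]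
  ring

/-- The probability that the open cluster of a vertex inside its subtree stops before depth `k`. -/
noncomputable def extinctBy (b : ℕ) (p : ℝ) : ℕ → ℝ
  | 0 => 0
  | k + 1 => (1 - p + p * extinctBy b p k) ^ b

/-- Given `s`, the probability that a vertex and its parent edge are not in an infinite descending
cluster, the probability of a descending path of length `n` of vertices with finite subtree
clusters. -/
noncomputable def dyingProb (b : ℕ) (s : ℝ) : ℕ → ℝ
  | 0 => s ^ b
  | n + 1 => s ^ b - (s - dyingProb b s n) ^ b

theorem IsBernT.real_diesBy (hP : IsBernT P p) (hp : 0 ≤ p) (k : ℕ) :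
    ∀ v : TVert b, P.real {ω | DiesBy ω k v} = extinctBy b p k := by
  induction k with
  | zero => simp [DiesBy, extinctBy]
  | succ k ih =>
    intro v
    simp only [DiesBy, Set.ofPred_forall, extinctBy]
    rw [hP.real_iInter_children v]
    · simp [hP.real_open_imp hp (List.cons_ne_nil _ v) (measurableSet_diesBy k _), ih]
    · intro c
      have := setOf_open_imp (List.cons_ne_nil c v) fun ω => DiesBy ω k (c :: v)
      rw [this]
      exact (measurableSet_edgeSigma_edgeOpen (List.suffix_refl _)).compl.union
        (edgeSigma_mono (below_subset_suffix _) _ (measurableSet_diesBy k _))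

theorem IsBernT.tendsto_extinctBy (hP : IsBernT P p) (hp : 0 ≤ p) (v : TVert b) :
    Tendsto (extinctBy b p) atTop (nhds (P.real {ω | Dies ω v})) := by
  have h : Tendsto (fun k => P {ω | DiesBy ω k v}) atTop (nhds (P {ω | Dies ω v})) := by
    simp only [Dies, Set.ofPred_exists]
    exact tendsto_measure_iUnion_atTop fun _ _ hkm _ h => DiesBy.mono hkm h
  have h' := (ENNReal.tendsto_toReal (measure_ne_top P _)).comp h
  exact h'.congr fun k => hP.real_diesBy hp k v

/-- Every edge has probability `1 - p + p q` of not leading down to an infinite cluster, where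
`q` is the extinction probability. -/
theorem IsBernT.real_diesOrClosed (hP : IsBernT P p) (hp : 0 ≤ p) {v : TVert b} (hv : v ≠ []) :
    P.real (diesOrClosed v) = 1 - p + p * P.real {ω | Dies ω []} := by
  rw [diesOrClosed, hP.real_open_imp hp hv (measurableSet_dies v)]
  rw [tendsto_nhds_unique (hP.tendsto_extinctBy hp v) (hP.tendsto_extinctBy hp [])]

theorem setOf_dies (v : TVert b) : {ω | Dies ω v} = ⋂ c, diesOrClosed (c :: v) := by
  ext ω
  simp [dies_iff (v := v), diesOrClosed]

theorem setOf_dyingPath_succ (n : ℕ) (v : TVert b) : {ω | DyingPath ω (n + 1) v} =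
    (⋂ c, diesOrClosed (c :: v)) \ ⋂ c, diesOrClosed (c :: v) \ {ω | DyingPath ω n (c :: v)} := by
  rw [← setOf_dies]
  ext ω
  simp only [DyingPath, Set.mem_ofPred_eq, Set.mem_sdiff, Set.mem_iInter, not_forall, not_and,
    not_not]
  refine and_congr_right fun h => exists_congr fun c => ⟨fun h _ => h, fun h' => h' ?_⟩
  exact dies_iff.1 h c

theorem IsBernT.real_dies (hP : IsBernT P p) (hp : 0 ≤ p) (v : TVert b) :
    P.real {ω | Dies ω v} = (1 - p + p * P.real {ω | Dies ω []}) ^ b := by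
  rw [setOf_dies, hP.real_iInter_children v fun c => measurableSet_diesOrClosed (by simp)]
  simp [hP.real_diesOrClosed hp]

theorem IsBernT.real_dyingPath (hP : IsBernT P p) (hp : 0 ≤ p) (n : ℕ) : ∀ v : TVert b,
    P.real {ω | DyingPath ω n v} =
      dyingProb b (1 - p + p * P.real {ω | Dies ω []}) n := by
  induction n with
  | zero => exact hP.real_dies hp
  | succ n ih =>
    intro v
    have hG : ∀ c, MeasurableSet[edgeSigma {l | c :: v <:+ l}] (diesOrClosed (c :: v)) :=
      fun c => measurableSet_diesOrClosed (by simp)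
    have hR : ∀ c, MeasurableSet[edgeSigma {l | c :: v <:+ l}] {ω | DyingPath ω n (c :: v)} :=
      fun c => edgeSigma_mono (below_subset_suffix _) _ (measurableSet_dyingPath n _)
    have hsub : ∀ c, {ω | DyingPath ω n (c :: v)} ⊆ diesOrClosed (c :: v) :=
      fun c ω h _ => DyingPath.dies h
    rw [setOf_dyingPath_succ, measureReal_sdiff (Set.iInter_mono fun c => Set.sdiff_subset)
        (MeasurableSet.iInter fun c => edgeSigma_le _ _ ((hG c).diff (hR c))),
      hP.real_iInter_children v hG, hP.real_iInter_children v fun c => (hG c).diff (hR c)]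
    have hdiff : ∀ c, P.real (diesOrClosed (c :: v) \ {ω | DyingPath ω n (c :: v)}) =
        P.real (diesOrClosed (c :: v)) - P.real {ω | DyingPath ω n (c :: v)} :=
      fun c => measureReal_sdiff (hsub c) (edgeSigma_le _ _ (hR c))
    simp [hdiff, hP.real_diesOrClosed hp, ih, dyingProb]

theorem IsBernT.measure_tXhasInf_ne_zero (hP : IsBernT P p) (hp : 0 ≤ p) {ε : ℝ} (hε : 0 < ε)
    (h : ∀ n, ε ≤ dyingProb b (1 - p + p * P.real {ω | Dies ω []}) n) :
    P {ω | tXhasInf ω} ≠ 0 := by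
  have hlim : Tendsto (fun n => P {ω | DyingPath ω n []}) atTop
      (nhds (P (⋂ n, {ω | DyingPath ω n []}))) :=
    tendsto_measure_iInter_atTop
      (fun n => (edgeSigma_le _ _ (measurableSet_dyingPath n [])).nullMeasurableSet)
      (antitone_nat_of_succ_le fun n ω h => DyingPath.of_succ h) ⟨0, measure_ne_top _ _⟩
  have hle : ENNReal.ofReal ε ≤ P (⋂ n, {ω | DyingPath ω n []}) :=
    ge_of_tendsto' hlim fun n => by
      rw [ENNReal.ofReal_le_iff_le_toReal (measure_ne_top _ _)]
      exact (h n).trans_eq (hP.real_dyingPath hp n []).symm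
  have hsub : ⋂ n, {ω : TConfig b | DyingPath ω n []} ⊆ {ω | tXhasInf ω} := fun ω hω =>
    tXhasInf_of_dyingPath fun n => Set.mem_iInter.1 hω n
  exact (((ENNReal.ofReal_pos.2 hε).trans_le hle).trans_le (measure_mono hsub)).ne'

theorem IsBernT.measure_tXhasInf_eq_zero (hP : IsBernT P p) (hp : 0 ≤ p)
    (h : Tendsto (dyingProb b (1 - p + p * P.real {ω | Dies ω []})) atTop (nhds 0)) :
    P {ω | tXhasInf ω} = 0 := by
  have hsub : {ω : TConfig b | tXhasInf ω} ⊆ ⋃ t, {ω | ∀ n, DyingPath ω n t} := fun ω hω =>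
    Set.mem_iUnion.2 (exists_dyingPath_of_tXhasInf hω)
  refine measure_mono_null hsub (measure_iUnion_null fun t => ?_)
  rw [← measureReal_eq_zero_iff]
  refine le_antisymm (ge_of_tendsto' h fun n => ?_) measureReal_nonneg
  rw [← hP.real_dyingPath hp n t]
  exact measureReal_mono fun ω hω => hω n

end Probability

theorem exists_isBernT (b : ℕ) {p : ℝ} (hp : p ∈ Set.Icc (0 : ℝ) 1) :
    ∃ P : Measure (TConfig b), IsBernT P p ∧ IsProbabilityMeasure P := by
  let μ : Measure Bool :=
    ENNReal.ofReal p • Measure.dirac true + ENNReal.ofReal (1 - p) • Measure.dirac false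
  have : IsProbabilityMeasure μ := ⟨by
    simp [μ, ← ENNReal.ofReal_add hp.1 (sub_nonneg.2 hp.2)]⟩
  refine ⟨Measure.infinitePi fun _ => μ, fun s _ f => ?_, inferInstance⟩
  have hset : {ω : TConfig b | ∀ l ∈ s, ω l = f l} = Set.pi s fun l => {f l} := by
    ext ω
    simp [Set.mem_pi]
  rw [hset, Measure.infinitePi_pi _ fun _ _ => MeasurableSet.singleton _]
  refine Finset.prod_congr rfl fun l _ => ?_
  cases f l <;> simp [μ]


/-- The solution `s` of `b * s ^ (b - 1) = 1`. -/
noncomputable def critRoot (b : ℕ) : ℝ := Real.exp (-(Real.log b / (b - 1)))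

/-- The closed form of the critical value. -/
noncomputable def critValue (b : ℕ) : ℝ := (1 - critRoot b) / (1 - critRoot b ^ b)

section Analysis

variable {b : ℕ}

theorem critRoot_pos (b : ℕ) : 0 < critRoot b := Real.exp_pos _

theorem critRoot_lt_one (hb : 2 ≤ b) : critRoot b < 1 := by
  have hb' : (2 : ℝ) ≤ b := by exact_mod_cast hb
  exact Real.exp_lt_one_iff.2 (neg_lt_zero.2 (div_pos (Real.log_pos (by linarith)) (by linarith)))

theorem mul_critRoot_pow (hb : 2 ≤ b) : b * critRoot b ^ (b - 1) = 1 := by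
  have hb' : (2 : ℝ) ≤ b := by exact_mod_cast hb
  have h : ((b - 1 : ℕ) : ℝ) * -(Real.log b / (b - 1)) = -Real.log b := by
    rw [Nat.cast_sub (by omega), Nat.cast_one]
    field_simp [show (b : ℝ) - 1 ≠ 0 by linarith]
  rw [critRoot, ← Real.exp_nat_mul, h, Real.exp_neg, Real.exp_log (by linarith)]
  exact mul_inv_cancel₀ (by linarith)

theorem critRoot_pow_lt_one (hb : 2 ≤ b) : critRoot b ^ b < 1 :=
  pow_lt_one₀ (critRoot_pos b).le (critRoot_lt_one hb) (by omega)

theorem critValue_pos (hb : 2 ≤ b) : 0 < critValue b :=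
  div_pos (sub_pos.2 (critRoot_lt_one hb)) (sub_pos.2 (critRoot_pow_lt_one hb))

theorem critValue_le_one (hb : 2 ≤ b) : critValue b ≤ 1 := by
  rw [critValue, div_le_one (sub_pos.2 (critRoot_pow_lt_one hb))]
  have := pow_le_of_le_one (critRoot_pos b).le (critRoot_lt_one hb).le (n := b) (by omega)
  linarith

theorem critValue_mul (hb : 2 ≤ b) :
    critValue b * (1 - critRoot b ^ b) = 1 - critRoot b :=
  div_mul_cancel₀ _ (sub_pos.2 (critRoot_pow_lt_one hb)).ne'

theorem critRoot_lt_of_lt_critValue (hb : 2 ≤ b) {p s : ℝ} (hp0 : 0 ≤ p)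
    (hp : p < critValue b) (hs0 : 0 ≤ s) (hs : s = 1 - p + p * s ^ b) : critRoot b < s := by
  by_contra! hle
  have hr := critRoot_lt_one hb
  have hgs := mul_neg_geom_sum s b
  have hgr := mul_neg_geom_sum (critRoot b) b
  have hmono : ∑ i ∈ Finset.range b, s ^ i ≤ ∑ i ∈ Finset.range b, critRoot b ^ i :=
    Finset.sum_le_sum fun i _ => pow_le_pow_left₀ hs0 hle i
  have h1 : p * ∑ i ∈ Finset.range b, s ^ i = 1 := by
    have : (1 - s) * (p * ∑ i ∈ Finset.range b, s ^ i) = (1 - s) * 1 := by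
      linear_combination p * hgs + hs
    exact mul_left_cancel₀ (by linarith) this
  have h2 : critValue b * ∑ i ∈ Finset.range b, critRoot b ^ i = 1 := by
    have : (1 - critRoot b) * (critValue b * ∑ i ∈ Finset.range b, critRoot b ^ i) =
        (1 - critRoot b) * 1 := by
      linear_combination critValue b * hgr + critValue_mul hb
    exact mul_left_cancel₀ (by linarith) this
  have hpos : 0 < ∑ i ∈ Finset.range b, critRoot b ^ i := by
    by_contra! h
    nlinarith [critValue_pos hb]
  nlinarith

theorem lt_critRoot_of_critValue_lt (hb : 2 ≤ b) {p q : ℝ} (hp : critValue b < p)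
    (hq : q ≤ critRoot b ^ b) : 1 - p + p * q < critRoot b := by
  nlinarith [critValue_mul hb, critRoot_pow_lt_one hb, critValue_pos hb]

theorem extinctBy_le (hb : 2 ≤ b) {p : ℝ} (hp : critValue b < p) (hp1 : p ≤ 1) (k : ℕ) :
    0 ≤ extinctBy b p k ∧ extinctBy b p k ≤ critRoot b ^ b := by
  have hp0 := (critValue_pos hb).trans hp
  induction k with
  | zero => exact ⟨le_rfl, (pow_pos (critRoot_pos b) b).le⟩
  | succ k ih =>
    have h0 : 0 ≤ p * extinctBy b p k := mul_nonneg hp0.le ih.1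
    refine ⟨pow_nonneg (by linarith) b, pow_le_pow_left₀ (by linarith)
      (lt_critRoot_of_critValue_lt hb hp ih.2).le b⟩

theorem dyingProb_mem (hb : 2 ≤ b) {s : ℝ} (hs0 : 0 ≤ s) (hs1 : s ≤ 1) (n : ℕ) :
    0 ≤ dyingProb b s n ∧ dyingProb b s n ≤ s := by
  have hsb : s ^ b ≤ s := pow_le_of_le_one hs0 hs1 (by omega)
  induction n with
  | zero => exact ⟨pow_nonneg hs0 b, hsb⟩
  | succ n ih =>
    obtain ⟨h0, h1⟩ := ih
    have h2 : (s - dyingProb b s n) ^ b ≤ s ^ b :=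
      pow_le_pow_left₀ (by linarith) (by linarith) b
    have h3 : 0 ≤ (s - dyingProb b s n) ^ b := pow_nonneg (by linarith) b
    exact ⟨by simp only [dyingProb]; linarith, by simp only [dyingProb]; linarith⟩

theorem tendsto_dyingProb_zero (hb : 2 ≤ b) {s : ℝ} (hs0 : 0 ≤ s) (hs1 : s ≤ 1)
    (h : b * s ^ (b - 1) < 1) : Tendsto (dyingProb b s) atTop (nhds 0) := by
  have hm0 : 0 ≤ b * s ^ (b - 1) := by positivity
  have hle : ∀ n, dyingProb b s n ≤ (b * s ^ (b - 1)) ^ n := fun n => by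
    induction n with
    | zero => simpa [dyingProb] using pow_le_one₀ hs0 hs1
    | succ n ih =>
      obtain ⟨h0, h1⟩ := dyingProb_mem hb hs0 hs1 n
      have := (le_abs_self _).trans (abs_pow_sub_pow_le s (s - dyingProb b s n) b)
      rw [sub_sub_cancel, abs_of_nonneg h0, abs_of_nonneg hs0,
        abs_of_nonneg (sub_nonneg.2 h1), max_eq_left (by linarith)] at this
      rw [pow_succ]
      refine (this.trans_eq (mul_assoc _ _ _)).trans ?_
      exact mul_le_mul_of_nonneg_right ih hm0
  exact squeeze_zero (fun n => (dyingProb_mem hb hs0 hs1 n).1) hle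
    (tendsto_pow_atTop_nhds_zero_of_lt_one hm0 h)

theorem exists_le_dyingProb (hb : 2 ≤ b) {s : ℝ} (hs0 : 0 < s) (hs1 : s ≤ 1)
    (h : 1 < b * s ^ (b - 1)) : ∃ ε > 0, ∀ n, ε ≤ dyingProb b s n := by
  have hd : HasDerivAt (fun r : ℝ => s ^ b - (s - r) ^ b) (b * s ^ (b - 1)) 0 := by
    simpa using (((hasDerivAt_id (0 : ℝ)).const_sub s).pow b).const_sub (s ^ b)
  have hev := hd.tendsto_slope_zero_right.eventually (lt_mem_nhds h)
  have hsmall : ∀ᶠ t : ℝ in nhdsWithin 0 (Set.Ioi 0), t < s ^ b :=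
    nhdsWithin_le_nhds (gt_mem_nhds (pow_pos hs0 b))
  obtain ⟨ε, ⟨h1, h2⟩, hε⟩ := ((hev.and hsmall).and self_mem_nhdsWithin).exists
  replace hε : 0 < ε := hε
  simp only [zero_add, sub_zero, sub_self, smul_eq_mul] at h1
  rw [inv_mul_eq_div, lt_div_iff₀ hε, one_mul] at h1
  refine ⟨ε, hε, fun n => ?_⟩
  induction n with
  | zero => exact h2.le
  | succ n ih =>
    have := (dyingProb_mem hb hs0.le hs1 n).2
    have : (s - dyingProb b s n) ^ b ≤ (s - ε) ^ b :=
      pow_le_pow_left₀ (by linarith) (by linarith) b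
    simp only [dyingProb]
    linarith

theorem IsBernT.measure_tXhasInf_ne_zero_of_lt (hb : 2 ≤ b) {P : Measure (TConfig b)}
    [IsProbabilityMeasure P] {p : ℝ} (hP : IsBernT P p) (hp0 : 0 ≤ p) (hp : p < critValue b) :
    P {ω | tXhasInf ω} ≠ 0 := by
  have hq := hP.real_dies hp0 []
  have hq0 : 0 ≤ P.real {ω | Dies ω []} := measureReal_nonneg
  have hq1 : P.real {ω | Dies ω []} ≤ 1 := measureReal_le_one
  have hp1 : p ≤ 1 := hp.le.trans (critValue_le_one hb)
  set q := P.real {ω | Dies ω []}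
  set s := 1 - p + p * q with hs
  have hs0 : 0 ≤ s := by nlinarith
  have hs1 : s ≤ 1 := by nlinarith
  have hlt := critRoot_lt_of_lt_critValue hb hp0 hp hs0 (by rw [← hq])
  have hpow : critRoot b ^ (b - 1) < s ^ (b - 1) :=
    pow_lt_pow_left₀ hlt (critRoot_pos b).le (by omega)
  have hb0 : (0 : ℝ) < b := by exact_mod_cast (by omega : 0 < b)
  obtain ⟨ε, hε, h⟩ := exists_le_dyingProb hb ((critRoot_pos b).trans hlt) hs1
    ((mul_critRoot_pow hb).symm.trans_lt (mul_lt_mul_of_pos_left hpow hb0))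
  exact hP.measure_tXhasInf_ne_zero hp0 hε h

theorem IsBernT.measure_tXhasInf_eq_zero_of_lt (hb : 2 ≤ b) {P : Measure (TConfig b)}
    [IsProbabilityMeasure P] {p : ℝ} (hP : IsBernT P p) (hp : critValue b < p) (hp1 : p ≤ 1) :
    P {ω | tXhasInf ω} = 0 := by
  have hp0 : 0 ≤ p := ((critValue_pos hb).trans hp).le
  have hq0 : 0 ≤ P.real {ω | Dies ω []} := measureReal_nonneg
  have hlt := lt_critRoot_of_critValue_lt hb hp
    (le_of_tendsto' (hP.tendsto_extinctBy hp0 []) fun k => (extinctBy_le hb hp hp1 k).2)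
  have hs0 : 0 ≤ 1 - p + p * P.real {ω | Dies ω []} := by nlinarith
  have hpow := pow_lt_pow_left₀ hlt hs0 (show b - 1 ≠ 0 by omega)
  have hb0 : (0 : ℝ) < b := by exact_mod_cast (by omega : 0 < b)
  exact hP.measure_tXhasInf_eq_zero hp0 (tendsto_dyingProb_zero hb hs0
    (hlt.trans (critRoot_lt_one hb)).le
    ((mul_lt_mul_of_pos_left hpow hb0).trans_eq (mul_critRoot_pow hb)))

theorem pfinT_eq_critValue (hb : 2 ≤ b) : pfinT b = critValue b := by
  have hmem : ∀ p, 0 ≤ p → p < critValue b → p ∈ {p | p ∈ Set.Icc (0 : ℝ) 1 ∧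
      ∀ P : Measure (TConfig b), IsBernT P p → IsProbabilityMeasure P →
        P {ω | tXhasInf ω} ≠ 0} := fun p hp0 hp =>
    ⟨⟨hp0, hp.le.trans (critValue_le_one hb)⟩, fun P hP _ =>
      hP.measure_tXhasInf_ne_zero_of_lt hb hp0 hp⟩
  refine csSup_eq_of_forall_le_of_forall_lt_exists_gt
    ⟨0, hmem 0 le_rfl (critValue_pos hb)⟩ ?_ ?_
  · rintro p ⟨hp, h⟩
    by_contra! hlt
    obtain ⟨P, hP, hprob⟩ := exists_isBernT b hp
    exact h P hP hprob (hP.measure_tXhasInf_eq_zero_of_lt hb hlt hp.2)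
  · intro w hw
    obtain ⟨p, hwp, hp⟩ := exists_between (max_lt hw (critValue_pos hb))
    exact ⟨p, hmem p ((le_max_right _ _).trans hwp.le) hp, (le_max_left _ _).trans_lt hwp⟩

theorem critRoot_two : critRoot 2 = 1 / 2 := by
  have := mul_critRoot_pow (le_refl 2)
  norm_num at this
  linarith

theorem tendsto_critValue_mul_div_log :
    Tendsto (fun b : ℕ => critValue b * b / Real.log b) atTop (nhds 1) := by
  have hx : Tendsto (fun b : ℕ => Real.log b / ((b : ℝ) - 1)) atTop (nhds 0) := by
    have := (Real.tendsto_pow_log_div_mul_add_atTop 1 (-1) 1 one_ne_zero).comp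
      (tendsto_natCast_atTop_atTop (R := ℝ))
    refine this.congr fun b => ?_
    simp [sub_eq_add_neg]
  have hev : ∀ᶠ b : ℕ in atTop, 2 ≤ b := eventually_ge_atTop 2
  have hx' : Tendsto (fun b : ℕ => Real.log b / ((b : ℝ) - 1)) atTop
      (nhdsWithin 0 {0}ᶜ) := by
    refine tendsto_nhdsWithin_iff.2 ⟨hx, hev.mono fun b hb => ?_⟩
    have hb' : (2 : ℝ) ≤ b := by exact_mod_cast hb
    exact (div_pos (Real.log_pos (by linarith)) (by linarith)).ne'
  have hd : HasDerivAt (fun x : ℝ => 1 - Real.exp (-x)) 1 0 := by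
    simpa using ((hasDerivAt_id (0 : ℝ)).neg.exp).const_sub 1
  have hslope := hd.tendsto_slope_zero.comp hx'
  have hratio := tendsto_natCast_div_add_atTop (-1 : ℝ)
  have hroot : Tendsto critRoot atTop (nhds 1) := by
    have := (Real.continuous_exp.tendsto _).comp hx.neg
    rwa [neg_zero, Real.exp_zero] at this
  have hpow : Tendsto (fun b : ℕ => critRoot b ^ b) atTop (nhds 0) := by
    have : Tendsto (fun b : ℕ => critRoot b * (b : ℝ)⁻¹) atTop (nhds (1 * 0)) :=
      hroot.mul (tendsto_inv_atTop_zero.comp tendsto_natCast_atTop_atTop)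
    rw [mul_zero] at this
    refine this.congr' (hev.mono fun b hb => ?_)
    have hb0 : (b : ℝ) ≠ 0 := by exact_mod_cast (by omega : b ≠ 0)
    obtain ⟨m, rfl⟩ : ∃ m, b = m + 1 := ⟨b - 1, by omega⟩
    have := mul_critRoot_pow hb
    rw [Nat.add_sub_cancel] at this
    beta_reduce
    rw [pow_succ, eq_inv_of_mul_eq_one_right this, mul_comm]
  have hmul := (hslope.mul hratio).mul ((hpow.const_sub 1).inv₀ (by norm_num))
  norm_num at hmul
  refine hmul.congr' (hev.mono fun b hb => ?_)
  have hb' : (2 : ℝ) ≤ b := by exact_mod_cast hb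
  have h1 : Real.log b ≠ 0 := (Real.log_pos (by linarith)).ne'
  have h2 : (b : ℝ) - 1 ≠ 0 := by linarith
  have h3 : 1 - critRoot b ^ b ≠ 0 := (sub_pos.2 (critRoot_pow_lt_one hb)).ne'
  have h4 : (b : ℝ) + -1 = b - 1 := rfl
  have h5 : Real.exp (-(Real.log b / (b - 1))) = critRoot b := rfl
  simp only [critValue, h4, h5]
  field_simp

end Analysis

/-- `p_fin(T_2) = 2/3`, and `p_fin(T_b) = (1 + o(1)) (log b)/b` as `b → ∞`. -/
theorem pfinT_two_and_asymptotics :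
    pfinT 2 = 2 / 3 ∧
    Tendsto (fun b : ℕ => pfinT b * b / Real.log b) atTop (nhds 1) := by
  refine ⟨?_, ?_⟩
  · rw [pfinT_eq_critValue le_rfl, critValue, critRoot_two]
    norm_num
  · refine tendsto_critValue_mul_div_log.congr' ((eventually_ge_atTop 2).mono fun b hb => ?_)
    simp only [pfinT_eq_critValue hb]
end
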